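/- arXiv:1106.2090 — 4 statements merged into one kernel-verified Lean document; each statement's English description precedes it below -/
import Mathlib

section
/- For the Hopf-Lax semigroup Q_t f on a metric space, the map t ↦ Q_t f(x) is locally Lipschitz on (0, t_*(x)) and its right and left derivatives satisfy d⁺/dt Q_t f(x) = -(D⁺(x,t))²/(2t²) and d⁻/dt Q_t f(x) = -(D⁻(x,t))²/(2t²). In particular s ↦ Q_s f(x) is differentiable at t iff D⁺(x,t)=D⁻(x,t). -/
open Filter Topology

/-- `F(t,x,y) = f(y) + d(x,y)²/(2t)`. -/
noncomputable def hopfLaxF {X : Type*} [MetricSpace X] (f : X → ℝ) (t : ℝ) (x y : X) : ℝ :=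
  f y + dist x y ^ 2 / (2 * t)

/-- `(y n)` is a minimizing sequence for `F(t,x,·)`, whose infimum value is `Q`. -/
def IsMinimizingSeq {X : Type*} [MetricSpace X] (f : X → ℝ) (t : ℝ) (x : X) (Q : ℝ)
    (y : ℕ → X) : Prop :=
  Tendsto (fun n => hopfLaxF f t x (y n)) atTop (𝓝 Q)

lemma hl_right {X : Type*} (f G : X → ℝ) (q : ℝ → ℝ) (a b A : ℝ) (hab : a < b)
    (hq : ∀ v ∈ Set.Icc a b, IsGLB (Set.range fun y => f y + v * G y) (q v))
    (h1 : ∀ ε > 0, ∃ δ > 0, ∀ y, f y + a * G y < q a + δ → A - ε < G y)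
    (h3 : ∀ ε > 0, ∀ δ > 0, ∃ y, f y + a * G y < q a + δ ∧ G y < A + ε) :
    HasDerivWithinAt q A (Set.Ici a) a := by
  have ha : a ∈ Set.Icc a b := ⟨le_rfl, hab.le⟩
  have hb : b ∈ Set.Icc a b := ⟨hab.le, le_rfl⟩
  rw [hasDerivWithinAt_iff_isLittleO, Asymptotics.isLittleO_iff]
  intro c hc
  obtain ⟨δ, hδ, hd⟩ := h1 c hc
  -- the linear function which has to be nonnegative
  have hcont : ∀ᶠ v in 𝓝[Set.Ici a] a,
      0 < δ - (v - a) / (b - a) * (q a + δ - q b) - (A - c) * (v - a) := by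
    have hC : Continuous fun v : ℝ =>
        δ - (v - a) / (b - a) * (q a + δ - q b) - (A - c) * (v - a) := by fun_prop
    have := hC.tendsto a
    simp only [sub_self, zero_div, zero_mul, mul_zero, sub_zero] at this
    exact (this.eventually (lt_mem_nhds hδ)).filter_mono nhdsWithin_le_nhds
  have hlt : ∀ᶠ v in 𝓝[Set.Ici a] a, v < b :=
    (eventually_lt_nhds hab).filter_mono nhdsWithin_le_nhds
  filter_upwards [hcont, hlt, self_mem_nhdsWithin] with v hv hvb hva
  have hva : a ≤ v := hva
  have hvm : v ∈ Set.Icc a b := ⟨hva, hvb.le⟩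
  have hup : q v ≤ q a + A * (v - a) := by
    apply le_of_forall_pos_le_add
    intro e he
    have hpos : 0 < 1 + (v - a) := by linarith
    obtain ⟨y, hy1, hy2⟩ := h3 (e / (1 + (v - a))) (by positivity) (e / (1 + (v - a)))
      (by positivity)
    have h := (hq v hvm).1 ⟨y, rfl⟩
    simp only at h
    have h5 : (v - a) * G y ≤ (v - a) * (A + e / (1 + (v - a))) :=
      mul_le_mul_of_nonneg_left hy2.le (by linarith)
    have h6 : e / (1 + (v - a)) * (1 + (v - a)) = e := by field_simp
    nlinarith
  have hlo : q a + (A - c) * (v - a) ≤ q v := by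
    apply (hq v hvm).2
    rintro _ ⟨y, rfl⟩
    simp only
    by_cases hy : f y + a * G y < q a + δ
    · have := mul_le_mul_of_nonneg_left (hd y hy).le (sub_nonneg.2 hva)
      have h0 := (hq a ha).1 ⟨y, rfl⟩
      simp only at h0
      linarith
    · push Not at hy
      have h := (hq b hb).1 ⟨y, rfl⟩
      simp only at h
      set l := (v - a) / (b - a) with hl
      have hba : 0 < b - a := by linarith
      have hl0 : 0 ≤ l := div_nonneg (by linarith) hba.le
      have hl1 : l ≤ 1 := by rw [hl, div_le_one hba]; linarith
      have hlv : v = (1 - l) * a + l * b := by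
        have : l * (b - a) = v - a := by rw [hl]; field_simp
        linarith
      have e1 := mul_le_mul_of_nonneg_left hy (sub_nonneg.2 hl1)
      have e2 := mul_le_mul_of_nonneg_left h hl0
      have e3 : f y + v * G y = (1 - l) * (f y + a * G y) + l * (f y + b * G y) := by
        conv_lhs => rw [hlv]
        ring
      rw [e3]
      linarith
  rw [Real.norm_eq_abs, Real.norm_eq_abs, abs_of_nonneg (sub_nonneg.2 hva), smul_eq_mul, abs_le]
  constructor
  · linarith
  · have := mul_nonneg hc.le (sub_nonneg.2 hva)
    linarith

lemma hl_left {X : Type*} (f G : X → ℝ) (q : ℝ → ℝ) (a b B : ℝ) (hab : b < a)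
    (hq : ∀ v ∈ Set.Icc b a, IsGLB (Set.range fun y => f y + v * G y) (q v))
    (h1 : ∀ ε > 0, ∃ δ > 0, ∀ y, f y + a * G y < q a + δ → G y < B + ε)
    (h3 : ∀ ε > 0, ∀ δ > 0, ∃ y, f y + a * G y < q a + δ ∧ B - ε < G y) :
    HasDerivWithinAt q B (Set.Iic a) a := by
  have h := hl_right f (fun y => - G y) (fun v => q (-v)) (-a) (-b) (-B) (by linarith) ?_ ?_ ?_
  · have h2 : HasDerivWithinAt (fun v : ℝ => -v) (-1) (Set.Iic a) a :=
      (hasDerivAt_neg a).hasDerivWithinAt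
    have := HasDerivWithinAt.comp (h₂ := fun v => q (-v)) a h h2
      (by intro v hv; simpa using hv)
    simpa [Function.comp_def] using this
  · intro v hv
    have := hq (-v) ⟨by linarith [hv.2], by linarith [hv.1]⟩
    simpa using this
  · intro ε hε
    obtain ⟨δ, hδ, h⟩ := h1 ε hε
    refine ⟨δ, hδ, fun y hy => ?_⟩
    have := h y (by simpa using hy)
    linarith
  · intro ε hε δ hδ
    obtain ⟨y, hy, h⟩ := h3 ε hε δ hδ
    exact ⟨y, by simpa using hy, by linarith⟩

lemma hl_concave {X : Type*} (f G : X → ℝ) (q : ℝ → ℝ) (J : Set ℝ) (hJ : Convex ℝ J)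
    (hq : ∀ v ∈ J, IsGLB (Set.range fun y => f y + v * G y) (q v)) : ConcaveOn ℝ J q := by
  refine ⟨hJ, fun u hu v hv s t hs ht hst => ?_⟩
  apply (hq _ (hJ hu hv hs ht hst)).2
  rintro _ ⟨y, rfl⟩
  have e1 := mul_le_mul_of_nonneg_left ((hq u hu).1 ⟨y, rfl⟩) hs
  have e2 := mul_le_mul_of_nonneg_left ((hq v hv).1 ⟨y, rfl⟩) ht
  simp only [smul_eq_mul] at *
  have : f y = s * f y + t * f y := by rw [← add_mul, hst, one_mul]
  nlinarith

section
variable {X : Type*} [MetricSpace X] {f : X → ℝ} {x : X} {t s Qt Qs : ℝ}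

lemma hl_seq_bdd (ht : 0 < t) (hts : t < s)
    (hs : IsGLB (Set.range (hopfLaxF f s x)) Qs) {y : ℕ → X}
    (hy : IsMinimizingSeq f t x Qt y) :
    IsBoundedUnder (· ≤ ·) atTop fun n => dist x (y n) := by
  have hc : 0 < 1 / (2 * t) - 1 / (2 * s) := by
    rw [sub_pos]; apply one_div_lt_one_div_of_lt <;> linarith
  set c := 1 / (2 * t) - 1 / (2 * s) with hcdef
  refine ⟨1 + (Qt + 1 - Qs) / c, ?_⟩
  rw [eventually_map]
  filter_upwards [hy.eventually (gt_mem_nhds (lt_add_one Qt))] with n hn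
  have h := hs.1 ⟨y n, rfl⟩
  unfold hopfLaxF at h hn
  have e : c * dist x (y n) ^ 2 =
    dist x (y n) ^ 2 / (2 * t) - dist x (y n) ^ 2 / (2 * s) := by rw [hcdef]; ring
  have h2 : dist x (y n) ^ 2 ≤ (Qt + 1 - Qs) / c := by
    rw [le_div_iff₀ hc]; linarith
  nlinarith [sq_nonneg (dist x (y n) - 1), dist_nonneg (x := x) (y := y n)]

lemma hl_bdd_below (y : ℕ → X) : IsBoundedUnder (· ≥ ·) atTop fun n => dist x (y n) :=
  ⟨0, by rw [eventually_map]; exact Eventually.of_forall fun n => dist_nonneg⟩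

/-- sequences of almost minimizers are minimizing -/
lemma hl_min_of (hQ : IsGLB (Set.range (hopfLaxF f t x)) Qt) {y : ℕ → X}
    (hy : ∀ n : ℕ, hopfLaxF f t x (y n) < Qt + 1 / ((n : ℝ) + 1)) :
    IsMinimizingSeq f t x Qt y := by
  refine tendsto_of_tendsto_of_tendsto_of_le_of_le (g := fun _ => Qt)
    (h := fun n : ℕ => Qt + 1 / ((n : ℝ) + 1)) tendsto_const_nhds ?_
    (fun n => hQ.1 ⟨y n, rfl⟩) (fun n => (hy n).le)
  simpa using (tendsto_one_div_add_atTop_nhds_zero_nat (𝕜 := ℝ)).const_add Qt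

lemma hl_near (hQ : IsGLB (Set.range (hopfLaxF f t x)) Qt) {δ : ℝ} (hδ : 0 < δ) :
    ∃ y, hopfLaxF f t x y < Qt + δ := by
  obtain ⟨_, ⟨y, rfl⟩, _, h⟩ := hQ.exists_between (lt_add_of_pos_right Qt hδ)
  exact ⟨y, h⟩

lemma hl_exists_seq (hQ : IsGLB (Set.range (hopfLaxF f t x)) Qt) :
    ∃ y, IsMinimizingSeq f t x Qt y := by
  choose y hy using fun n : ℕ => hl_near hQ (δ := 1 / ((n : ℝ) + 1)) (by positivity)
  exact ⟨y, hl_min_of hQ hy⟩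

variable {D : ℝ}

lemma hl_Dm_nonneg (ht : 0 < t) (hts : t < s)
    (hs : IsGLB (Set.range (hopfLaxF f s x)) Qs)
    (hD : IsGLB {L : ℝ | ∃ y : ℕ → X,
      IsMinimizingSeq f t x Qt y ∧ L = atTop.liminf fun n => dist x (y n)} D) : 0 ≤ D := by
  apply hD.2
  rintro L ⟨y, hy, rfl⟩
  exact le_liminf_of_le (hl_seq_bdd ht hts hs hy).isCoboundedUnder_ge
    (Eventually.of_forall fun n => dist_nonneg)

lemma hl_Dp_nonneg (ht : 0 < t) (hts : t < s)
    (hQ : IsGLB (Set.range (hopfLaxF f t x)) Qt)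
    (hs : IsGLB (Set.range (hopfLaxF f s x)) Qs)
    (hD : IsLUB {L : ℝ | ∃ y : ℕ → X,
      IsMinimizingSeq f t x Qt y ∧ L = atTop.limsup fun n => dist x (y n)} D) : 0 ≤ D := by
  obtain ⟨y, hy⟩ := hl_exists_seq hQ
  refine le_trans ?_ (hD.1 ⟨y, hy, rfl⟩)
  exact le_limsup_of_frequently_le (Frequently.of_forall fun n => dist_nonneg)
    (hl_seq_bdd ht hts hs hy)

lemma hl_Dm1 (ht : 0 < t) (hts : t < s)
    (hQ : IsGLB (Set.range (hopfLaxF f t x)) Qt)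
    (hs : IsGLB (Set.range (hopfLaxF f s x)) Qs)
    (hD : IsGLB {L : ℝ | ∃ y : ℕ → X,
      IsMinimizingSeq f t x Qt y ∧ L = atTop.liminf fun n => dist x (y n)} D) :
    ∀ ε > 0, ∃ δ > 0, ∀ y, hopfLaxF f t x y < Qt + δ → D ^ 2 - ε < dist x y ^ 2 := by
  intro ε hε
  have hD0 := hl_Dm_nonneg ht hts hs hD
  by_contra! hcon
  choose y hy1 hy2 using fun n : ℕ => hcon (1 / ((n : ℝ) + 1)) (by positivity)
  have hm := hl_min_of hQ hy1
  have h1 := hD.1 ⟨y, hm, rfl⟩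
  have h2 : (atTop.liminf fun n => dist x (y n)) ≤ √(D ^ 2 - ε) :=
    liminf_le_of_frequently_le (Frequently.of_forall fun n => Real.le_sqrt_of_sq_le (hy2 n))
      (hl_bdd_below y)
  have h0 : 0 ≤ D ^ 2 - ε := (sq_nonneg _).trans (hy2 0)
  have h3 : √(D ^ 2 - ε) < D := by
    rw [Real.sqrt_lt h0 hD0]; linarith
  linarith

lemma hl_Dp1 (ht : 0 < t) (hts : t < s)
    (hQ : IsGLB (Set.range (hopfLaxF f t x)) Qt)
    (hs : IsGLB (Set.range (hopfLaxF f s x)) Qs)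
    (hD : IsLUB {L : ℝ | ∃ y : ℕ → X,
      IsMinimizingSeq f t x Qt y ∧ L = atTop.limsup fun n => dist x (y n)} D) :
    ∀ ε > 0, ∃ δ > 0, ∀ y, hopfLaxF f t x y < Qt + δ → dist x y ^ 2 < D ^ 2 + ε := by
  intro ε hε
  have hD0 := hl_Dp_nonneg ht hts hQ hs hD
  by_contra! hcon
  choose y hy1 hy2 using fun n : ℕ => hcon (1 / ((n : ℝ) + 1)) (by positivity)
  have hm := hl_min_of hQ hy1
  have h1 := hD.1 ⟨y, hm, rfl⟩
  have h2 : √(D ^ 2 + ε) ≤ (atTop.limsup fun n => dist x (y n)) :=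
    le_limsup_of_frequently_le
      (Frequently.of_forall fun n => (Real.sqrt_le_left dist_nonneg).2 (hy2 n))
      (hl_seq_bdd ht hts hs hm)
  have h3 : D < √(D ^ 2 + ε) := by
    apply Real.lt_sqrt_of_sq_lt; linarith
  linarith

lemma hl_Dm3 (ht : 0 < t) (hts : t < s)
    (hs : IsGLB (Set.range (hopfLaxF f s x)) Qs)
    (hD : IsGLB {L : ℝ | ∃ y : ℕ → X,
      IsMinimizingSeq f t x Qt y ∧ L = atTop.liminf fun n => dist x (y n)} D) :
    ∀ ε > 0, ∀ δ > 0, ∃ y, hopfLaxF f t x y < Qt + δ ∧ dist x y ^ 2 < D ^ 2 + ε := by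
  intro ε hε δ hδ
  have h3 : D < √(D ^ 2 + ε) := by
    apply Real.lt_sqrt_of_sq_lt; linarith
  obtain ⟨L, ⟨y, hy, rfl⟩, -, hL⟩ := hD.exists_between h3
  have hf := frequently_lt_of_liminf_lt (hl_seq_bdd ht hts hs hy).isCoboundedUnder_ge hL
  obtain ⟨n, hn1, hn2⟩ :=
    (hf.and_eventually (hy.eventually (gt_mem_nhds (lt_add_of_pos_right Qt hδ)))).exists
  exact ⟨y n, hn2, (Real.lt_sqrt dist_nonneg).1 hn1⟩

lemma hl_Dp3 (ht : 0 < t) (hts : t < s)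
    (hQ : IsGLB (Set.range (hopfLaxF f t x)) Qt)
    (hs : IsGLB (Set.range (hopfLaxF f s x)) Qs)
    (hD : IsLUB {L : ℝ | ∃ y : ℕ → X,
      IsMinimizingSeq f t x Qt y ∧ L = atTop.limsup fun n => dist x (y n)} D) :
    ∀ ε > 0, ∀ δ > 0, ∃ y, hopfLaxF f t x y < Qt + δ ∧ D ^ 2 - ε < dist x y ^ 2 := by
  intro ε hε δ hδ
  have hD0 := hl_Dp_nonneg ht hts hQ hs hD
  by_cases h0 : 0 ≤ D ^ 2 - ε
  · have h3 : √(D ^ 2 - ε) < D := by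
      rw [Real.sqrt_lt h0 hD0]; linarith
    obtain ⟨L, ⟨y, hy, rfl⟩, hL, -⟩ := hD.exists_between h3
    have hf := frequently_lt_of_lt_limsup (hl_bdd_below y).isCoboundedUnder_le hL
    obtain ⟨n, hn1, hn2⟩ :=
      (hf.and_eventually (hy.eventually (gt_mem_nhds (lt_add_of_pos_right Qt hδ)))).exists
    exact ⟨y n, hn2, (Real.sqrt_lt h0 dist_nonneg).1 hn1⟩
  · obtain ⟨y, hy⟩ := hl_near hQ hδ
    exact ⟨y, hy, by nlinarith [sq_nonneg (dist x y)]⟩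

end

/-- Time derivative of the Hopf-Lax function: `t ↦ Q_t f(x)` is locally Lipschitz on
`(0, t_*(x))`, its right derivative is `-(D⁺(x,t))²/(2t²)`, its left derivative is
`-(D⁻(x,t))²/(2t²)`, and it is differentiable at `t` iff `D⁺(x,t) = D⁻(x,t)`. -/
theorem hopfLax_time_derivative {X : Type*} [MetricSpace X] (f : X → ℝ)
    (Q : ℝ → X → ℝ) (x : X) (T : ℝ)
    (hQ : ∀ t ∈ Set.Ioo (0 : ℝ) T, IsGLB (Set.range (hopfLaxF f t x)) (Q t x))
    (Dp Dm : ℝ → ℝ)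
    (hDp : ∀ t ∈ Set.Ioo (0 : ℝ) T, IsLUB {L : ℝ | ∃ y : ℕ → X,
      IsMinimizingSeq f t x (Q t x) y ∧ L = atTop.limsup fun n => dist x (y n)} (Dp t))
    (hDm : ∀ t ∈ Set.Ioo (0 : ℝ) T, IsGLB {L : ℝ | ∃ y : ℕ → X,
      IsMinimizingSeq f t x (Q t x) y ∧ L = atTop.liminf fun n => dist x (y n)} (Dm t)) :
    (∀ t ∈ Set.Ioo (0 : ℝ) T, ∃ ε > (0 : ℝ), ∃ K : NNReal,
      LipschitzOnWith K (fun r => Q r x) (Set.Ioo (t - ε) (t + ε) ∩ Set.Ioo (0 : ℝ) T)) ∧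
    (∀ t ∈ Set.Ioo (0 : ℝ) T,
      HasDerivWithinAt (fun r => Q r x) (-(Dp t) ^ 2 / (2 * t ^ 2)) (Set.Ici t) t ∧
      HasDerivWithinAt (fun r => Q r x) (-(Dm t) ^ 2 / (2 * t ^ 2)) (Set.Iic t) t) ∧
    (∀ t ∈ Set.Ioo (0 : ℝ) T,
      (∃ D : ℝ, HasDerivAt (fun r => Q r x) D t) ↔ Dp t = Dm t) := by
  have hF : ∀ u : ℝ, hopfLaxF f (1 / (2 * u)) x = fun y => f y + u * dist x y ^ 2 := by
    intro u; funext y; unfold hopfLaxF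
    congr 1
    by_cases hu : u = 0
    · simp [hu]
    · field_simp
  have hF2 : ∀ t : ℝ, ∀ y, f y + 1 / (2 * t) * dist x y ^ 2 = hopfLaxF f t x y := by
    intro t y; unfold hopfLaxF; ring
  have hinv : ∀ t : ℝ, 1 / (2 * (1 / (2 * t))) = t := by
    intro t
    by_cases ht : t = 0
    · simp [ht]
    · field_simp
  set q : ℝ → ℝ := fun u => Q (1 / (2 * u)) x with hqdef
  set w : ℝ → ℝ := fun t => 1 / (2 * t) with hw
  have hww : ∀ t, w (w t) = t := hinv
  have hqw : ∀ t, q (w t) = Q t x := by intro t; simp only [hqdef, hw, hinv]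
  have hqw' : (fun r => Q r x) = q ∘ w := by funext t; simp [hqw]
  have hwpos : ∀ t, 0 < t → 0 < w t := by intro t ht; simp only [hw]; positivity
  have hwlt : ∀ s t, 0 < s → s < t → w t < w s := by
    intro s t hs hst
    simp only [hw]; apply one_div_lt_one_div_of_lt <;> linarith
  have hwle : ∀ s t, 0 < s → s ≤ t → w t ≤ w s := by
    intro s t hs hst
    simp only [hw]; apply one_div_le_one_div_of_le <;> linarith
  have hq : ∀ v, w v ∈ Set.Ioo 0 T →
      IsGLB (Set.range fun y => f y + v * dist x y ^ 2) (q v) := by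
    intro v hv
    have := hQ (w v) hv
    rwa [hF v] at this
  have hwd : ∀ t, 0 < t → HasDerivAt w (-1 / (2 * t ^ 2)) t := by
    intro t ht
    have h := (hasDerivAt_inv ht.ne').const_mul (1 / 2 : ℝ)
    have hfun : w = fun y => 1 / 2 * y⁻¹ := by funext z; simp [hw, mul_comm]
    have hval : -1 / (2 * t ^ 2) = 1 / 2 * -(t ^ 2)⁻¹ := by field_simp
    rw [hfun, hval]
    exact h
  have hD : ∀ t ∈ Set.Ioo (0 : ℝ) T,
      HasDerivWithinAt (fun r => Q r x) (-(Dp t) ^ 2 / (2 * t ^ 2)) (Set.Ici t) t ∧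
      HasDerivWithinAt (fun r => Q r x) (-(Dm t) ^ 2 / (2 * t ^ 2)) (Set.Iic t) t := by
    intro t ht
    obtain ⟨s, hts, hsT⟩ := exists_between ht.2
    have hs : s ∈ Set.Ioo 0 T := ⟨ht.1.trans hts, hsT⟩
    have e1 : -(Dp t) ^ 2 / (2 * t ^ 2) = (Dp t) ^ 2 * (-1 / (2 * t ^ 2)) := by ring
    have e2 : -(Dm t) ^ 2 / (2 * t ^ 2) = (Dm t) ^ 2 * (-1 / (2 * t ^ 2)) := by ring
    rw [hqw', e1, e2]
    constructor
    · refine HasDerivWithinAt.comp (h₂ := q) (s' := Set.Iic (w t)) t ?_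
        (hwd t ht.1).hasDerivWithinAt (fun r hr => hwle t r ht.1 hr)
      refine hl_left f (fun y => dist x y ^ 2) q (w t) (w s) _ (hwlt t s ht.1 hts) ?_ ?_ ?_
      · intro v hv
        apply hq
        have hv0 : 0 < v := (hwpos s hs.1).trans_le hv.1
        refine ⟨hwpos v hv0, ?_⟩
        have := hwle _ _ (hwpos s hs.1) hv.1
        rw [hww] at this
        exact this.trans_lt hsT
      · simp only [hw, hF2]
        simp only [hqdef, hinv]
        exact hl_Dp1 ht.1 hts (hQ t ht) (hQ s hs) (hDp t ht)
      · simp only [hw, hF2]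
        simp only [hqdef, hinv]
        exact hl_Dp3 ht.1 hts (hQ t ht) (hQ s hs) (hDp t ht)
    · have hloc : Set.Ioc 0 t ∈ 𝓝[Set.Iic t] t := by
        rw [← Set.Ioi_inter_Iic]
        exact inter_mem (mem_nhdsWithin_of_mem_nhds (Ioi_mem_nhds ht.1)) self_mem_nhdsWithin
      suffices hsuff : HasDerivWithinAt (q ∘ w) (Dm t ^ 2 * (-1 / (2 * t ^ 2))) (Set.Ioc 0 t) t from
        hsuff.mono_of_mem_nhdsWithin hloc
      refine HasDerivWithinAt.comp (h₂ := q) (s' := Set.Ici (w t)) t ?_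
        (hwd t ht.1).hasDerivWithinAt (fun r hr => hwle r t hr.1 hr.2)
      refine hl_right f (fun y => dist x y ^ 2) q (w t) (w t + 1) _ (by linarith) ?_ ?_ ?_
      · intro v hv
        apply hq
        have hv0 : 0 < v := (hwpos t ht.1).trans_le hv.1
        refine ⟨hwpos v hv0, ?_⟩
        have := hwle _ _ (hwpos t ht.1) hv.1
        rw [hww] at this
        exact this.trans_lt ht.2
      · simp only [hw, hF2]
        simp only [hqdef, hinv]
        exact hl_Dm1 ht.1 hts (hQ t ht) (hQ s hs) (hDm t ht)
      · simp only [hw, hF2]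
        simp only [hqdef, hinv]
        exact hl_Dm3 ht.1 hts (hQ s hs) (hDm t ht)
  refine ⟨?_, hD, ?_⟩
  · intro t ht
    have hT : 0 < T := ht.1.trans ht.2
    have hJ : ∀ v ∈ Set.Ioi (w T), w v ∈ Set.Ioo 0 T := by
      intro v hv
      have hv0 : 0 < v := (hwpos T hT).trans hv
      refine ⟨hwpos v hv0, ?_⟩
      have := hwlt _ _ (hwpos T hT) hv
      rwa [hww] at this
    have hconc : ConcaveOn ℝ (Set.Ioi (w T)) q :=
      hl_concave f (fun y => dist x y ^ 2) q _ (convex_Ioi _) (fun v hv => hq v (hJ v hv))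
    have hlip := hconc.locallyLipschitzOn isOpen_Ioi
    have hwt : w t ∈ Set.Ioi (w T) := hwlt t T ht.1 ht.2
    obtain ⟨K, V, hV, hK⟩ := hlip hwt
    have hV2 : V ∈ 𝓝 (w t) := by rwa [isOpen_Ioi.nhdsWithin_eq hwt] at hV
    have hcd : ContDiffAt ℝ 1 w t := by
      simp only [hw]
      exact contDiffAt_const.div (by fun_prop) (by have := ht.1; positivity)
    obtain ⟨K2, U, hU, hK2⟩ := hcd.exists_lipschitzOnWith
    have hU2 : U ∩ w ⁻¹' V ∈ 𝓝 t := inter_mem hU (hcd.continuousAt hV2)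
    obtain ⟨ε, hε, hball⟩ := Metric.mem_nhds_iff.1 hU2
    refine ⟨ε, hε, K * K2, ?_⟩
    rw [hqw']
    rw [Real.ball_eq_Ioo] at hball
    exact hK.comp (hK2.mono fun r hr => (hball hr.1).1) (fun r hr => (hball hr.1).2)
  · intro t ht
    obtain ⟨s, hts, hsT⟩ := exists_between ht.2
    have hs : s ∈ Set.Ioo 0 T := ⟨ht.1.trans hts, hsT⟩
    obtain ⟨hp, hm⟩ := hD t ht
    constructor
    · rintro ⟨D, hd⟩
      have h1 := (uniqueDiffOn_Ici t t Set.self_mem_Ici).eq_deriv _ hp hd.hasDerivWithinAt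
      have h2 := (uniqueDiffOn_Iic t t Set.self_mem_Iic).eq_deriv _ hm hd.hasDerivWithinAt
      have h3 := h1.trans h2.symm
      have ht0 : (2 * t ^ 2) ≠ 0 := by have := ht.1; positivity
      have h4 : Dp t ^ 2 = Dm t ^ 2 := by
        have := (div_left_inj' ht0).1 h3
        linarith
      exact (sq_eq_sq₀ (hl_Dp_nonneg ht.1 hts (hQ t ht) (hQ s hs) (hDp t ht))
        (hl_Dm_nonneg ht.1 hts (hQ s hs) (hDm t ht))).1 h4
    · intro h
      rw [← h] at hm
      refine ⟨-(Dp t) ^ 2 / (2 * t ^ 2), ?_⟩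
      have := hm.union hp
      rw [Set.Iic_union_Ici] at this
      exact hasDerivWithinAt_univ.1 this
end

section
/- On a metric space, for every x with t ∈ (0,t_*(x)) the Hopf-Lax function satisfies the Hamilton-Jacobi subsolution property: d⁺/dt Q_t f(x) + |∇ Q_t f|²(x)/2 ≤ 0. -/
open Filter Topology

/-- The local Lipschitz constant (slope) `|∇g|(x) = limsup_{y→x} |g(y)-g(x)|/d(y,x)`
(set to `0` at isolated points). -/
noncomputable def locSlope {X : Type*} [MetricSpace X] (g : X → ℝ) (x : X) : EReal :=
  max 0 (Filter.limsup (fun y => ((|g y - g x| / dist y x : ℝ) : EReal))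
    (nhdsWithin x {x}ᶜ))


/-- Key estimate: difference quotients in space are controlled by the left derivative in
`s = 1/(2t)`. -/
lemma hopfLax_core {X : Type*} [MetricSpace X] (f : X → ℝ) (h : X → ℝ → ℝ) (σ s0 : ℝ)
    (hσ : 0 ≤ σ) (hs0 : σ < s0)
    (hle : ∀ z y s, σ < s → h z s ≤ f y + s * dist z y ^ 2)
    (happ : ∀ z s ε, σ < s → 0 < ε → ∃ y, f y + s * dist z y ^ 2 < h z s + ε)
    (x : X) (a : ℝ) (hder : HasDerivWithinAt (h x) a (Set.Iio s0) s0)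
    (R : ℝ) (hR : 0 < R) (haR : a < R ^ 2) :
    ∀ᶠ z in 𝓝[≠] x, |h z s0 - h x s0| / dist z x ≤ 2 * s0 * R + (s0 + 1) * dist z x := by
  have hs0p : 0 < s0 := hσ.trans_lt hs0
  have hsl := (hasDerivWithinAt_iff_tendsto_slope' Set.self_notMem_Iio).mp hder
  obtain ⟨s2, hs2a, hs2b⟩ :=
    ((hsl.eventually_lt_const haR).and (Ioo_mem_nhdsLT hs0)).exists
  obtain ⟨hσ2, h20⟩ := hs2b
  have hs2p : 0 < s2 := hσ.trans_lt hσ2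
  have hΔ : h x s0 - h x s2 < R ^ 2 * (s0 - s2) := by
    rw [slope_comm, slope_def_field, div_lt_iff₀ (by linarith)] at hs2a
    exact hs2a
  have hR2 : 0 < R ^ 2 := by positivity
  obtain ⟨s1, h21, h1⟩ : ∃ s1, s2 < s1 ∧ s1 < min s0 (s0 - (h x s0 - h x s2) / R ^ 2) := by
    apply exists_between
    rw [lt_min_iff]
    refine ⟨h20, ?_⟩
    have : (h x s0 - h x s2) / R ^ 2 < s0 - s2 := by
      rw [div_lt_iff₀ hR2]; linarith
    linarith
  obtain ⟨h10, h1'⟩ := lt_min_iff.mp h1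
  have hΔ1 : h x s0 - h x s2 < R ^ 2 * (s0 - s1) := by
    have : (h x s0 - h x s2) / R ^ 2 < s0 - s1 := by linarith
    rw [div_lt_iff₀ hR2] at this; linarith
  obtain ⟨C, hC⟩ : ∃ C, C * (s1 - s2) = s1 * s2 :=
    ⟨s1 * s2 / (s1 - s2), div_mul_cancel₀ _ (by linarith)⟩
  -- lower semicontinuity
  have hlow : ∀ z, h x s2 - C * dist z x ^ 2 ≤ h z s1 := by
    intro z
    refine le_of_forall_pos_le_add fun ε hε => ?_
    obtain ⟨y, hy⟩ := happ z s1 ε (hσ2.trans h21) hε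
    have h3 := hle x y s2 hσ2
    have htri : dist x y ≤ dist z x + dist z y := dist_triangle_left _ _ _
    have hsq : dist x y ^ 2 ≤ (dist z x + dist z y) ^ 2 := by gcongr
    have hq : s2 * (dist z x + dist z y) ^ 2 ≤ s1 * dist z y ^ 2 + C * dist z x ^ 2 := by
      have hp : 0 < s1 - s2 := by linarith
      have : 0 ≤ (s1 - s2) * (s1 * dist z y ^ 2 + C * dist z x ^ 2
          - s2 * (dist z x + dist z y) ^ 2) := by
        have e : (s1 - s2) * (s1 * dist z y ^ 2 + C * dist z x ^ 2
          - s2 * (dist z x + dist z y) ^ 2) = ((s1 - s2) * dist z y - s2 * dist z x) ^ 2 := by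
          linear_combination (dist z x ^ 2) * hC
        rw [e]; positivity
      have := nonneg_of_mul_nonneg_right this hp
      linarith
    have := mul_le_mul_of_nonneg_left hsq hs2p.le
    linarith
  -- comparison
  have hcmp : ∀ z w y, dist w y ≤ R → f y + s0 * dist w y ^ 2 < h w s0 + dist z w ^ 2 →
      h z s0 - h w s0 ≤ dist z w * (2 * s0 * R + (s0 + 1) * dist z w) := by
    intro z w y hwy hmin
    have h3 := hle z y s0 hs0
    have htri : dist z y ≤ dist z w + dist w y := dist_triangle _ _ _
    have hsq : dist z y ^ 2 ≤ (dist z w + dist w y) ^ 2 := by gcongr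
    have h4 := mul_le_mul_of_nonneg_left hsq hs0p.le
    have h5 : s0 * dist z w * dist w y ≤ s0 * dist z w * R := by gcongr
    nlinarith
  -- smallness
  have hdist : Tendsto (fun z => dist z x) (𝓝 x) (𝓝 0) := by
    have : Continuous fun z => dist z x := by fun_prop
    simpa using this.tendsto x
  have hsmall : ∀ᶠ z in 𝓝[≠] x,
      dist z x * (2 * s0 * R + (s0 + 1) * dist z x) + (1 + |C|) * dist z x ^ 2
        < R ^ 2 * (s0 - s1) - (h x s0 - h x s2) := by
    have : Tendsto (fun z => dist z x * (2 * s0 * R + (s0 + 1) * dist z x)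
        + (1 + |C|) * dist z x ^ 2) (𝓝 x) (𝓝 0) := by
      have : Continuous fun z => dist z x * (2 * s0 * R + (s0 + 1) * dist z x)
        + (1 + |C|) * dist z x ^ 2 := by fun_prop
      simpa using this.tendsto x
    exact (this.eventually_lt_const (by linarith)).filter_mono nhdsWithin_le_nhds
  filter_upwards [hsmall, self_mem_nhdsWithin] with z hz hzx
  have hd : 0 < dist z x := dist_pos.mpr hzx
  have hd2 : 0 < dist z x ^ 2 := by positivity
  have hCd : C * dist z x ^ 2 ≤ |C| * dist z x ^ 2 := by gcongr; exact le_abs_self C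
  have hCd0 : 0 ≤ |C| * dist z x ^ 2 := by positivity
  have hlin : 0 ≤ dist z x * (2 * s0 * R + (s0 + 1) * dist z x) := by positivity
  rw [div_le_iff₀ hd, mul_comm]
  have hup : h z s0 - h x s0 ≤ dist z x * (2 * s0 * R + (s0 + 1) * dist z x) := by
    obtain ⟨y, hy⟩ := happ x s0 (dist z x ^ 2) hs0 hd2
    refine hcmp z x y ?_ hy
    have h3 := hle x y s2 hσ2
    have h4 : dist x y ^ 2 * (s0 - s1) ≤ dist x y ^ 2 * (s0 - s2) := by gcongr
    have : dist x y ^ 2 * (s0 - s1) < R ^ 2 * (s0 - s1) := by nlinarith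
    have := lt_of_mul_lt_mul_right this (by linarith)
    exact (lt_of_pow_lt_pow_left₀ 2 hR.le this).le
  rw [abs_le]
  refine ⟨?_, hup⟩
  obtain ⟨y, hy⟩ := happ z s0 (dist z x ^ 2) hs0 hd2
  have hkey := hcmp x z y ?_ (by rwa [dist_comm x z])
  · rw [dist_comm x z] at hkey; linarith
  · have h3 := hle z y s1 (hσ2.trans h21)
    have h4 := hlow z
    have : dist z y ^ 2 * (s0 - s1) < R ^ 2 * (s0 - s1) := by nlinarith
    have := lt_of_mul_lt_mul_right this (by linarith)
    exact (lt_of_pow_lt_pow_left₀ 2 hR.le this).le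

/-- Subsolution property of the Hopf-Lax formula for the Hamilton-Jacobi equation: for
`t ∈ (0, t_*(x))` (encoded by the requirement that `Q r z` is a real greatest lower
bound of `F(r,z,·)` for all `r ∈ (0,T)` and all `z`), the right time derivative
`d⁺/dt Q_t f(x)` exists and `d⁺/dt Q_t f(x) + |∇ Q_t f|²(x)/2 ≤ 0`. -/
theorem hopfLax_HJ_subsolution {X : Type*} [MetricSpace X] (f : X → ℝ)
    (Q : ℝ → X → ℝ) (T : ℝ)
    (hQ : ∀ r ∈ Set.Ioo (0 : ℝ) T, ∀ z : X, IsGLB (Set.range (hopfLaxF f r z)) (Q r z))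
    (x : X) (t : ℝ) (htT : t ∈ Set.Ioo (0 : ℝ) T) :
    ∃ D : ℝ, HasDerivWithinAt (fun r => Q r x) D (Set.Ici t) t ∧
      (D : EReal) + (locSlope (fun z => Q t z) x) ^ 2 / 2 ≤ 0 := by
  obtain ⟨ht0, htT'⟩ := htT
  have hT : 0 < T := ht0.trans htT'
  set h : X → ℝ → ℝ := fun z s => Q (1 / (2 * s)) z with hh
  set σ : ℝ := 1 / (2 * T) with hσdef
  set s0 : ℝ := 1 / (2 * t) with hs0def
  have hσ : 0 < σ := by positivity
  have hs0 : σ < s0 := by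
    rw [hσdef, hs0def]; gcongr
  have hs0p : 0 < s0 := hσ.trans hs0
  have hinv : ∀ r : ℝ, 1 / (2 * (1 / (2 * r))) = r := by
    intro r
    by_cases hr : r = 0
    · simp [hr]
    · field_simp
  have hmem : ∀ s, σ < s → 1 / (2 * s) ∈ Set.Ioo (0 : ℝ) T := by
    intro s hs
    have hsp : 0 < s := hσ.trans hs
    refine ⟨by positivity, ?_⟩
    rw [← hinv T, ← hσdef]; gcongr
  have hF : ∀ s z y, σ < s → hopfLaxF f (1 / (2 * s)) z y = f y + s * dist z y ^ 2 := by
    intro s z y hs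
    have hsp : 0 < s := hσ.trans hs
    unfold hopfLaxF
    field_simp
  have hle : ∀ z y s, σ < s → h z s ≤ f y + s * dist z y ^ 2 := by
    intro z y s hs
    rw [← hF s z y hs]
    exact (hQ _ (hmem s hs) z).1 ⟨y, rfl⟩
  have happ : ∀ z s ε, σ < s → 0 < ε → ∃ y, f y + s * dist z y ^ 2 < h z s + ε := by
    intro z s ε hs hε
    obtain ⟨_, ⟨y, rfl⟩, hy⟩ :=
      (isGLB_lt_iff (hQ _ (hmem s hs) z)).mp (lt_add_of_pos_right _ hε)
    exact ⟨y, by rw [← hF s z y hs]; exact hy⟩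
  have hconv : ConvexOn ℝ (Set.Ioi σ) (fun s => - h x s) := by
    refine ⟨convex_Ioi σ, ?_⟩
    intro u hu v hv p q hp hq hpq
    have huv := convex_Ioi σ hu hv hp hq hpq
    simp only [smul_eq_mul] at huv ⊢
    suffices p * h x u + q * h x v ≤ h x (p * u + q * v) by linarith
    refine le_of_forall_pos_le_add fun ε hε => ?_
    obtain ⟨y, hy⟩ := happ x _ ε huv hε
    have h1 := mul_le_mul_of_nonneg_left (hle x y u hu) hp
    have h2 := mul_le_mul_of_nonneg_left (hle x y v hv) hq
    have h3 : f y = p * f y + q * f y := by rw [← add_mul, hpq, one_mul]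
    nlinarith
  obtain ⟨b, hb⟩ : ∃ b, HasDerivWithinAt (fun s => - h x s) b (Set.Iio s0) s0 :=
    ⟨_, hconv.hasDerivWithinAt_leftDeriv_of_mem_interior (by simpa using hs0)⟩
  obtain ⟨a, hder⟩ : ∃ a, HasDerivWithinAt (h x) a (Set.Iio s0) s0 :=
    ⟨-b, by simpa using hb.fun_neg⟩
  have ha : 0 ≤ a := by
    have hsl := (hasDerivWithinAt_iff_tendsto_slope' Set.self_notMem_Iio).mp hder
    refine ge_of_tendsto hsl ?_
    filter_upwards [Ioo_mem_nhdsLT hs0] with s hs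
    rw [slope_comm, slope_def_field]
    refine div_nonneg ?_ (by linarith [hs.2])
    suffices h x s ≤ h x s0 by linarith
    refine le_of_forall_pos_le_add fun ε hε => ?_
    obtain ⟨y, hy⟩ := happ x _ ε hs0 hε
    have h1 := hle x y s hs.1
    have h2 : s * dist x y ^ 2 ≤ s0 * dist x y ^ 2 := by gcongr; exact hs.2.le
    linarith
  refine ⟨a * (-(1 / (2 * t ^ 2))), ?_, ?_⟩
  · have hg : HasDerivWithinAt (fun r : ℝ => 1 / (2 * r)) (-(1 / (2 * t ^ 2))) (Set.Ici t) t := by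
      have := ((hasDerivAt_inv ht0.ne').const_mul (1 / 2 : ℝ)).hasDerivWithinAt (s := Set.Ici t)
      have e1 : (fun r : ℝ => 1 / (2 * r)) = fun r : ℝ => 1 / 2 * r⁻¹ := by
        funext r; simp [mul_comm]
      have e2 : -(1 / (2 * t ^ 2)) = 1 / 2 * -(t ^ 2)⁻¹ := by field_simp
      rw [e1, e2]
      exact this
    have hd' : HasDerivWithinAt (h x) a (Set.Iic s0) ((fun r : ℝ => 1 / (2 * r)) t) :=
      hasDerivWithinAt_Iio_iff_Iic.mp hder
    have hcomp := hd'.comp t hg (fun r hr => by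
      have hr' : t ≤ r := hr
      show 1 / (2 * r) ≤ 1 / (2 * t)
      gcongr)
    refine hcomp.congr_of_mem (fun r _ => ?_) Set.self_mem_Ici
    simp only [Function.comp, hh, hinv]
  · have hslope : locSlope (fun z => Q t z) x ≤ ((√a / t : ℝ) : EReal) := by
      unfold locSlope
      refine max_le (by exact_mod_cast (by positivity : 0 ≤ √a / t)) ?_
      refine EReal.le_of_forall_lt_iff_le.mp fun c hc => ?_
      have hc' : √a / t < c := by exact_mod_cast hc
      have e : √a / t = 2 * s0 * √a := by rw [hs0def]; field_simp
      rw [e] at hc'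
      obtain ⟨R, hR1, hR2⟩ : ∃ R, √a < R ∧ R < c / (2 * s0) := by
        apply exists_between
        rw [lt_div_iff₀ (by positivity)]; linarith
      rw [lt_div_iff₀ (by positivity)] at hR2
      have hRp : 0 < R := (Real.sqrt_nonneg a).trans_lt hR1
      have hcore := hopfLax_core f h σ s0 hσ.le hs0 hle happ x a hder R hRp
        ((Real.sqrt_lt' hRp).mp hR1)
      have hsm : ∀ᶠ z in 𝓝[≠] x, 2 * s0 * R + (s0 + 1) * dist z x < c := by
        have : Continuous fun z => 2 * s0 * R + (s0 + 1) * dist z x := by fun_prop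
        have := this.tendsto x
        exact (this.eventually_lt_const (by simp; linarith)).filter_mono nhdsWithin_le_nhds
      refine limsup_le_of_le (by isBoundedDefault) ?_
      filter_upwards [hcore, hsm] with z h1 h2
      have e2 : ∀ z, h z s0 = Q t z := fun z => by simp only [hh, hs0def, hinv]
      rw [e2, e2] at h1
      exact_mod_cast h1.trans h2.le
    have h0 : 0 ≤ locSlope (fun z => Q t z) x := le_max_left _ _
    obtain ⟨L, hL⟩ : ∃ L : ℝ, locSlope (fun z => Q t z) x = (L : EReal) := by
      refine ⟨_, (EReal.coe_toReal ?_ ?_).symm⟩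
      · exact ne_top_of_le_ne_top (EReal.coe_ne_top _) hslope
      · exact ne_bot_of_le_ne_bot (by simp) h0
    rw [hL] at hslope h0 ⊢
    have hL0 : 0 ≤ L := by exact_mod_cast h0
    have hL1 : L ≤ √a / t := by exact_mod_cast hslope
    have hL2 : L ^ 2 ≤ a / t ^ 2 := by
      calc L ^ 2 ≤ (√a / t) ^ 2 := by gcongr
        _ = a / t ^ 2 := by rw [div_pow, Real.sq_sqrt ha]
    have hreal : a * (-(1 / (2 * t ^ 2))) + L ^ 2 / 2 ≤ 0 := by
      have : a * (-(1 / (2 * t ^ 2))) = - (a / t ^ 2) / 2 := by field_simp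
      rw [this]; linarith
    have e2 : ((L : EReal)) ^ 2 / 2 = ((L ^ 2 / 2 : ℝ) : EReal) := by
      rw [EReal.coe_div, EReal.coe_pow]; rfl
    rw [e2]
    exact_mod_cast hreal
end

section
/- Let L ∈ L¹(0,1) be nonnegative with ∫₀¹ L > 0, let g:[0,1]→[0,∞] be measurable with ∫₀¹ g·L dt < ∞, and let w:[0,1]→ℝ∪{-∞} be upper semicontinuous with w > -∞ a.e. on {L ≠ 0}. Assume w(s) - w(t) ≤ g(t)·|∫ₛᵗ L(r) dr| for all t with w(t) > -∞, and that w is constant on every interval [a,b] with ∫ₐᵇ L = 0. Then w is everywhere finite and absolutely continuous on [0,1], with |w(s)-w(t)| ≤ 2∫ₛᵗ g·L dr for s < t. -/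
open Filter Topology MeasureTheory
open scoped ENNReal

/-- Selection of a good point in an interval of positive `L`-mass. -/
lemma acc_pick (L : ℝ → ℝ) (hL0 : ∀ r ∈ Set.Icc (0 : ℝ) 1, 0 ≤ L r)
    (hLint : IntegrableOn L (Set.Icc (0 : ℝ) 1))
    (g : ℝ → ℝ≥0∞) (hg : Measurable g) (w : ℝ → EReal)
    (hae : ∀ᵐ r ∂(volume.restrict (Set.Icc (0 : ℝ) 1)), L r ≠ 0 → w r ≠ ⊥)
    {a b : ℝ} (ha : 0 ≤ a) (hab : a ≤ b) (hb : b ≤ 1) (hpos : 0 < ∫ r in a..b, L r) :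
    ∃ τ ∈ Set.Icc a b, w τ ≠ ⊥ ∧ g τ * ENNReal.ofReal (∫ r in a..b, L r) ≤
      ∫⁻ r in Set.Icc a b, g r * ENNReal.ofReal (L r) := by
  have hsub : Set.Icc a b ⊆ Set.Icc (0 : ℝ) 1 := Set.Icc_subset_Icc ha hb
  have hLi : IntegrableOn L (Set.Icc a b) := hLint.mono_set hsub
  have hLm : AEMeasurable (fun r => ENNReal.ofReal (L r)) (volume.restrict (Set.Icc a b)) :=
    hLi.aemeasurable.ennreal_ofReal
  set μ := (volume.restrict (Set.Icc a b)).withDensity (fun r => ENNReal.ofReal (L r)) with hμ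
  have hmass : μ Set.univ = ENNReal.ofReal (∫ r in a..b, L r) := by
    rw [hμ, withDensity_apply _ MeasurableSet.univ, Measure.restrict_univ,
      intervalIntegral.integral_of_le hab, ← integral_Icc_eq_integral_Ioc,
      ofReal_integral_eq_lintegral_ofReal hLi]
    filter_upwards [ae_restrict_mem measurableSet_Icc] with r hr using hL0 r (hsub hr)
  have hH0 : ENNReal.ofReal (∫ r in a..b, L r) ≠ 0 := by simpa using hpos
  have hμ0 : μ ≠ 0 := by
    intro h
    rw [h] at hmass
    exact hH0 (by simpa using hmass.symm)
  haveI : IsFiniteMeasure μ := ⟨by rw [hmass]; exact ENNReal.ofReal_lt_top⟩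
  have hgood : ∀ᵐ r ∂μ, r ∈ Set.Icc a b ∧ w r ≠ ⊥ := by
    rw [hμ, ae_withDensity_iff' hLm]
    filter_upwards [ae_restrict_mem measurableSet_Icc, ae_restrict_of_ae_restrict_of_subset hsub hae]
      with r hr hr2 h0
    refine ⟨hr, hr2 ?_⟩
    rintro h
    simp [h] at h0
  obtain ⟨τ, hτ, hle⟩ := exists_notMem_null_le_laverage hμ0 hg.aemeasurable (ae_iff.1 hgood)
  have hτ' : τ ∈ Set.Icc a b ∧ w τ ≠ ⊥ := by
    by_contra h
    exact hτ h
  refine ⟨τ, hτ'.1, hτ'.2, ?_⟩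
  rw [laverage_eq, hmass, hμ, lintegral_withDensity_eq_lintegral_mul₀ hLm hg.aemeasurable] at hle
  rw [ENNReal.le_div_iff_mul_le (Or.inl hH0) (Or.inl ENNReal.ofReal_ne_top)] at hle
  refine hle.trans (le_of_eq ?_)
  refine lintegral_congr fun r => ?_
  simp [mul_comm]

/-- One step of the chain. -/
lemma acc_step {x y : EReal} {p q : ℝ≥0∞} {c : ℝ} (hx : y ≠ ⊥) (hy : y ≠ ⊤) (hc : 0 ≤ c)
    (h : x - y ≤ (p : EReal) * (q : EReal)) (hpq : p * q ≤ ENNReal.ofReal c) :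
    x ≤ y + ((c : ℝ) : EReal) := by
  have h1 : x - y ≤ (c : EReal) := by
    refine h.trans ?_
    rw [← EReal.coe_ennreal_mul]
    refine (EReal.coe_ennreal_le_coe_ennreal_iff.2 hpq).trans ?_
    rw [EReal.coe_ennreal_ofReal, max_eq_left hc]
  rw [EReal.sub_le_iff_le_add (Or.inl hx) (Or.inl hy)] at h1
  rwa [add_comm]

/-- Chains of good points joining `s` to `t` with control `I`. -/
def AccChain (g : ℝ → ℝ≥0∞) (w : ℝ → EReal) (l : ℝ → ℝ) (D s t I : ℝ) : Prop :=
  ∀ n : ℕ, ∃ τ J : ℕ → ℝ,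
    (∀ i ≤ n, τ i ∈ Set.Icc (0 : ℝ) 1 ∧ w (τ i) ≠ ⊥ ∧ 0 ≤ J i ∧
      g (τ i) * ENNReal.ofReal (D / (n + 1)) ≤ ENNReal.ofReal (J i)) ∧
    (∀ i < n, |l (τ (i + 1)) - l (τ i)| ≤ 2 * (D / (n + 1))) ∧
    |l (τ 0) - l s| ≤ D / (n + 1) ∧ |l t - l (τ n)| ≤ D / (n + 1) ∧
    ∑ i ∈ Finset.range (n + 1), J i ≤ I

lemma AccChain.symm {g : ℝ → ℝ≥0∞} {w : ℝ → EReal} {l : ℝ → ℝ} {D s t I : ℝ}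
    (h : AccChain g w l D s t I) : AccChain g w l D t s I := by
  intro n
  obtain ⟨τ, J, h1, h2, h3, h4, h5⟩ := h n
  refine ⟨fun i => τ (n - i), fun i => J (n - i), fun i hi => h1 _ (by omega), ?_, ?_, ?_, ?_⟩
  · intro i hi
    have := h2 (n - (i + 1)) (by omega)
    rw [abs_sub_comm]
    rwa [show n - (i + 1) + 1 = n - i by omega] at this
  · rw [abs_sub_comm]; simpa using h4
  · rw [abs_sub_comm]; simpa using h3
  · have := Finset.sum_range_reflect J (n + 1)
    simp only [Nat.add_sub_cancel] at this
    rw [this]; exact h5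

lemma acc_main {g : ℝ → ℝ≥0∞} {w : ℝ → EReal} {l : ℝ → ℝ} {D s t I : ℝ}
    (hwtop : ∀ r, w r ≠ ⊤)
    (husc : UpperSemicontinuousOn w (Set.Icc (0 : ℝ) 1))
    (hl : ContinuousOn l (Set.Icc (0 : ℝ) 1))
    (hmain : ∀ t ∈ Set.Icc (0 : ℝ) 1, w t ≠ ⊥ → ∀ s ∈ Set.Icc (0 : ℝ) 1,
      w s - w t ≤ (g t : EReal) * ((ENNReal.ofReal |l t - l s| : ℝ≥0∞) : EReal))
    (hconst : ∀ a ∈ Set.Icc (0 : ℝ) 1, ∀ b ∈ Set.Icc (0 : ℝ) 1, l a = l b → w a = w b)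
    (hs : s ∈ Set.Icc (0 : ℝ) 1) (ht : t ∈ Set.Icc (0 : ℝ) 1)
    (h : AccChain g w l D s t I) {c : ℝ} (hc : (c : EReal) ≤ w t) :
    ((c - 2 * I : ℝ) : EReal) ≤ w s := by
  have key : ∀ n : ℕ, ∃ x, (x ∈ Set.Icc (0 : ℝ) 1 ∩ w ⁻¹' Set.Ici ((c - 2 * I : ℝ) : EReal)) ∧
      |l x - l s| ≤ D / (n + 1) := by
    intro n
    obtain ⟨τ, J, h1, h2, h3, h4, h5⟩ := h n
    refine ⟨τ 0, ⟨(h1 0 (by omega)).1, ?_⟩, h3⟩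
    have step : ∀ i ≤ n, ∀ y ∈ Set.Icc (0 : ℝ) 1, |l y - l (τ i)| ≤ 2 * (D / (n + 1)) →
        w y ≤ w (τ i) + ((2 * J i : ℝ) : EReal) := by
      intro i hi y hy hly
      obtain ⟨a1, a2, a3, a4⟩ := h1 i hi
      refine acc_step a2 (hwtop _) (by linarith) (hmain _ a1 a2 y hy) ?_
      rw [abs_sub_comm]
      calc g (τ i) * ENNReal.ofReal |l y - l (τ i)|
          ≤ g (τ i) * ENNReal.ofReal (2 * (D / (n + 1))) := by gcongr
        _ = 2 * (g (τ i) * ENNReal.ofReal (D / (n + 1))) := by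
            rw [ENNReal.ofReal_mul (by norm_num)]
            simp only [ENNReal.ofReal_ofNat]; ring
        _ ≤ 2 * ENNReal.ofReal (J i) := by gcongr
        _ = ENNReal.ofReal (2 * J i) := by
            rw [ENNReal.ofReal_mul (by norm_num)]; simp
    have chain : ∀ k ≤ n, w (τ k) ≤ w (τ 0) + ((∑ i ∈ Finset.range k, 2 * J i : ℝ) : EReal) := by
      intro k
      induction k with
      | zero => intro _; simp
      | succ k ih =>
        intro hk
        refine (step k (by omega) _ (h1 (k + 1) hk).1 (h2 k (by omega))).trans ?_
        rw [Finset.sum_range_succ, EReal.coe_add, ← add_assoc]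
        gcongr
        exact ih (by omega)
    have hD : 0 ≤ D / ((n : ℝ) + 1) := (abs_nonneg _).trans h3
    have hfin := step n le_rfl t ht (by linarith)
    have h6 : (c : EReal) ≤ w (τ 0) + ((2 * I : ℝ) : EReal) := by
      calc (c : EReal) ≤ w (τ n) + ((2 * J n : ℝ) : EReal) := hc.trans hfin
        _ ≤ w (τ 0) + ((∑ i ∈ Finset.range n, 2 * J i : ℝ) : EReal) + ((2 * J n : ℝ) : EReal) := by
            gcongr; exact chain n le_rfl
        _ = w (τ 0) + ((∑ i ∈ Finset.range (n + 1), 2 * J i : ℝ) : EReal) := by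
            rw [Finset.sum_range_succ, EReal.coe_add, ← add_assoc]
        _ ≤ w (τ 0) + ((2 * I : ℝ) : EReal) := by
            gcongr
            rw [← Finset.mul_sum]
            linarith
    simp only [Set.mem_preimage, Set.mem_Ici]
    rw [EReal.coe_sub, EReal.sub_le_iff_le_add (Or.inl (EReal.coe_ne_bot _))
      (Or.inl (EReal.coe_ne_top _))]
    exact h6
  choose x hx hxl using key
  have hK := UpperSemicontinuousOn.isCompact_inter_preimage_Ici husc isCompact_Icc
    ((c - 2 * I : ℝ) : EReal)
  obtain ⟨p, hp, φ, hφ, hlim⟩ := hK.tendsto_subseq hx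
  have hlp : Tendsto (fun n => l (x (φ n))) atTop (𝓝 (l p)) := by
    have h1 := hl p hp.1
    exact h1.tendsto.comp (tendsto_nhdsWithin_iff.2 ⟨hlim, Eventually.of_forall fun n => (hx _).1⟩)
  have hls : Tendsto (fun n => l (x n)) atTop (𝓝 (l s)) := by
    rw [tendsto_iff_dist_tendsto_zero]
    refine squeeze_zero (fun _ => dist_nonneg) (fun n => (Real.dist_eq _ _).trans_le (hxl n)) ?_
    have := (tendsto_one_div_add_atTop_nhds_zero_nat (𝕜 := ℝ)).const_mul D
    simpa [div_eq_mul_inv] using this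
  have heq : l p = l s := tendsto_nhds_unique hlp (hls.comp hφ.tendsto_atTop)
  rw [← hconst p hp.1 s hs heq]
  exact hp.2

/-- Existence of chains. -/
lemma acc_exists {g : ℝ → ℝ≥0∞} {w : ℝ → EReal} {l Φ : ℝ → ℝ} {s t : ℝ}
    (hl : ContinuousOn l (Set.Icc (0 : ℝ) 1)) (hlm : MonotoneOn l (Set.Icc (0 : ℝ) 1))
    (hΦ : MonotoneOn Φ (Set.Icc (0 : ℝ) 1))
    (hpick : ∀ a b, 0 ≤ a → a ≤ b → b ≤ 1 → l a < l b → ∃ τ ∈ Set.Icc a b, w τ ≠ ⊥ ∧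
      g τ * ENNReal.ofReal (l b - l a) ≤ ENNReal.ofReal (Φ b - Φ a))
    (hs : s ∈ Set.Icc (0 : ℝ) 1) (ht : t ∈ Set.Icc (0 : ℝ) 1) (hst : s ≤ t) (hlt : l s < l t) :
    AccChain g w l (l t - l s) s t (Φ t - Φ s) := by
  intro n
  set h := (l t - l s) / ((n : ℝ) + 1) with hh
  have hn : (0 : ℝ) < (n : ℝ) + 1 := by positivity
  have hpos : 0 < h := div_pos (by linarith) hn
  have hhn : ((n : ℝ) + 1) * h = l t - l s := by rw [hh]; field_simp
  have hstsub : Set.Icc s t ⊆ Set.Icc (0 : ℝ) 1 := Set.Icc_subset_Icc hs.1 ht.2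
  -- subdivision points
  have hex : ∀ i : ℕ, ∃ a, (i ≤ n + 1 → a ∈ Set.Icc s t ∧ l a = l s + i * h) ∧
      (i = 0 → a = s) ∧ (i = n + 1 → a = t) := by
    intro i
    rcases Nat.eq_zero_or_pos i with rfl | hi
    · exact ⟨s, fun _ => ⟨⟨le_rfl, hst⟩, by simp⟩, fun _ => rfl, fun h => by omega⟩
    by_cases hi2 : i = n + 1
    · subst hi2
      refine ⟨t, fun _ => ⟨⟨hst, le_rfl⟩, ?_⟩, fun h => by omega, fun _ => rfl⟩
      push_cast; linarith
    by_cases hi3 : i ≤ n + 1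
    · have hiR : (i : ℝ) ≤ (n : ℝ) + 1 := by exact_mod_cast hi3
      obtain ⟨a, ha, hla⟩ := intermediate_value_Icc hst (hl.mono hstsub)
        (show l s + i * h ∈ Set.Icc (l s) (l t) from
          ⟨by have : 0 ≤ (i : ℝ) * h := by positivity
              linarith, by nlinarith⟩)
      exact ⟨a, fun _ => ⟨ha, hla⟩, fun h => by omega, fun h => by omega⟩
    · exact ⟨0, fun h => by omega, fun h => by omega, fun h => by omega⟩
  choose a ha ha0 han using hex
  have hval : ∀ i ≤ n, l (a (i + 1)) - l (a i) = h := by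
    intro i hi
    rw [(ha (i + 1) (by omega)).2, (ha i (by omega)).2]; push_cast; ring
  have hmono : ∀ i ≤ n, a i ≤ a (i + 1) := by
    intro i hi
    by_contra hcon
    have := hlm (hstsub (ha (i + 1) (by omega)).1) (hstsub (ha i (by omega)).1) (not_le.1 hcon).le
    have := hval i hi
    linarith
  have hτ : ∀ i, ∃ x, i ≤ n → x ∈ Set.Icc (a i) (a (i + 1)) ∧ w x ≠ ⊥ ∧
      g x * ENNReal.ofReal h ≤ ENNReal.ofReal (Φ (a (i + 1)) - Φ (a i)) := by
    intro i
    by_cases hi : i ≤ n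
    · obtain ⟨x, hx, hx2, hx3⟩ := hpick (a i) (a (i + 1)) (hstsub (ha i (by omega)).1).1 (hmono i hi)
        (hstsub (ha (i + 1) (by omega)).1).2 (by have := hval i hi; linarith)
      rw [hval i hi] at hx3
      exact ⟨x, fun _ => ⟨hx, hx2, hx3⟩⟩
    · exact ⟨0, fun h => absurd h hi⟩
  choose τ hτ using hτ
  have hmem : ∀ i ≤ n, τ i ∈ Set.Icc (0 : ℝ) 1 := fun i hi =>
    ⟨(hstsub (ha i (by omega)).1).1.trans (hτ i hi).1.1,
      (hτ i hi).1.2.trans (hstsub (ha (i + 1) (by omega)).1).2⟩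
  have hlo : ∀ i ≤ n, l s + i * h ≤ l (τ i) := fun i hi => by
    rw [← (ha i (by omega)).2]
    exact hlm (hstsub (ha i (by omega)).1) (hmem i hi) (hτ i hi).1.1
  have hup : ∀ i ≤ n, l (τ i) ≤ l s + i * h + h := fun i hi => by
    have h1 := hlm (hmem i hi) (hstsub (ha (i + 1) (by omega)).1) (hτ i hi).1.2
    rw [(ha (i + 1) (by omega)).2] at h1
    push_cast at h1; linarith
  refine ⟨τ, fun i => Φ (a (i + 1)) - Φ (a i), ?_, ?_, ?_, ?_, ?_⟩
  · intro i hi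
    refine ⟨hmem i hi, (hτ i hi).2.1, ?_, (hτ i hi).2.2⟩
    exact sub_nonneg.2 (hΦ (hstsub (ha i (by omega)).1) (hstsub (ha (i + 1) (by omega)).1) (hmono i hi))
  · intro i hi
    have b1 := hlo i hi.le
    have b2 := hup i hi.le
    have b3 := hlo (i + 1) hi
    have b4 := hup (i + 1) hi
    push_cast at b3 b4
    rw [abs_le]; constructor <;> linarith
  · have b1 := hlo 0 (by omega)
    have b2 := hup 0 (by omega)
    simp only [Nat.cast_zero, zero_mul, add_zero] at b1 b2
    rw [abs_le]; constructor <;> linarith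
  · have b1 := hlo n le_rfl
    have b2 := hup n le_rfl
    rw [abs_le]; constructor <;> linarith
  · rw [Finset.sum_range_sub (fun i => Φ (a i)), han (n + 1) rfl, ha0 0 rfl]

/-- Domination by the increments of an integral gives absolute continuity. -/
lemma acc_ac {f k : ℝ → ℝ} (hk : IntegrableOn k (Set.Icc (0 : ℝ) 1))
    (hf : ∀ s t : ℝ, s ∈ Set.Icc (0 : ℝ) 1 → t ∈ Set.Icc (0 : ℝ) 1 → s ≤ t →
      |f t - f s| ≤ 2 * ((∫ r in (0 : ℝ)..t, k r) - ∫ r in (0 : ℝ)..s, k r)) :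
    ∃ h : ℝ → ℝ, IntegrableOn h (Set.Icc (0 : ℝ) 1) ∧
        ∀ r ∈ Set.Icc (0 : ℝ) 1, f r = f 0 + ∫ u in (0 : ℝ)..r, h u := by
  have hki : IntervalIntegrable k volume 0 1 :=
    (intervalIntegrable_iff_integrableOn_Icc_of_le zero_le_one).2 hk
  have hΦ := hki.absolutelyContinuousOnInterval_intervalIntegral (c := 0) (by simp)
  have hf' : ∀ s t : ℝ, s ∈ Set.Icc (0 : ℝ) 1 → t ∈ Set.Icc (0 : ℝ) 1 →
      dist (f s) (f t) ≤ 2 * dist (∫ r in (0 : ℝ)..s, k r) (∫ r in (0 : ℝ)..t, k r) := by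
    intro s t hs ht
    rcases le_total s t with h | h
    · have := hf s t hs ht h
      rw [Real.dist_eq, Real.dist_eq, abs_sub_comm, abs_sub_comm (∫ r in (0 : ℝ)..s, k r)]
      exact this.trans (by gcongr; exact le_abs_self _)
    · have := hf t s ht hs h
      rw [Real.dist_eq, Real.dist_eq]
      exact this.trans (by gcongr; exact le_abs_self _)
  have hfac : AbsolutelyContinuousOnInterval f 0 1 := by
    rw [absolutelyContinuousOnInterval_iff] at hΦ ⊢
    intro ε hε
    obtain ⟨δ, hδ, H⟩ := hΦ (ε / 2) (by linarith)
    refine ⟨δ, hδ, fun E hE hEδ => ?_⟩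
    have h1 := H E hE hEδ
    have h2 : ∑ i ∈ Finset.range E.1, dist (f (E.2 i).1) (f (E.2 i).2) ≤
        ∑ i ∈ Finset.range E.1, 2 * dist (∫ r in (0 : ℝ)..(E.2 i).1, k r)
          (∫ r in (0 : ℝ)..(E.2 i).2, k r) := by
      refine Finset.sum_le_sum fun i hi => ?_
      have := hE.1 i hi
      rw [Set.uIcc_of_le zero_le_one] at this
      exact hf' _ _ this.1 this.2
    rw [← Finset.mul_sum] at h2
    linarith
  refine ⟨deriv f, ?_, ?_⟩
  · exact (intervalIntegrable_iff_integrableOn_Icc_of_le zero_le_one).1 hfac.intervalIntegrable_deriv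
  · intro r hr
    have : AbsolutelyContinuousOnInterval f 0 r := by
      refine hfac.mono ?_
      rw [Set.uIcc_of_le zero_le_one, Set.uIcc_of_le hr.1]
      exact Set.Icc_subset_Icc le_rfl hr.2
    rw [this.integral_deriv_eq_sub]; ring

/-- Absolute continuity criterion (Lemma 2.3 of Ambrosio-Gigli-Savaré): if
`L ∈ L¹(0,1)` is nonnegative with `∫₀¹ L > 0`, `g : [0,1] → [0,∞]` is measurable with
`∫₀¹ g·L < ∞`, and `w : [0,1] → ℝ ∪ {-∞}` is upper semicontinuous, finite a.e. on
`{L ≠ 0}`, satisfies `w(s) - w(t) ≤ g(t)·|∫ₛᵗ L|` whenever `w(t) > -∞`, and is constant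
on every interval where `∫ L = 0`, then `w` is everywhere finite and absolutely
continuous on `[0,1]`, with `|w(t) - w(s)| ≤ 2 ∫ₛᵗ g·L` for `s ≤ t`. -/
theorem absolute_continuity_criterion
    (L : ℝ → ℝ) (hL0 : ∀ r ∈ Set.Icc (0 : ℝ) 1, 0 ≤ L r)
    (hLint : IntegrableOn L (Set.Icc (0 : ℝ) 1))
    (hLpos : 0 < ∫ r in (0 : ℝ)..1, L r)
    (g : ℝ → ℝ≥0∞) (hg : Measurable g)
    (hgL : ∫⁻ r in Set.Icc (0 : ℝ) 1, g r * ENNReal.ofReal (L r) ≠ ⊤)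
    (w : ℝ → EReal) (hwtop : ∀ r, w r ≠ ⊤)
    (husc : UpperSemicontinuousOn w (Set.Icc (0 : ℝ) 1))
    (hae : ∀ᵐ r ∂(volume.restrict (Set.Icc (0 : ℝ) 1)), L r ≠ 0 → w r ≠ ⊥)
    (hmain : ∀ t ∈ Set.Icc (0 : ℝ) 1, w t ≠ ⊥ → ∀ s ∈ Set.Icc (0 : ℝ) 1,
      w s - w t ≤ (g t : EReal) * ((ENNReal.ofReal |∫ r in s..t, L r| : ℝ≥0∞) : EReal))
    (hconst : ∀ a b : ℝ, a ∈ Set.Icc (0 : ℝ) 1 → b ∈ Set.Icc (0 : ℝ) 1 → a ≤ b →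
      (∫ r in a..b, L r) = 0 → ∀ s ∈ Set.Icc a b, ∀ u ∈ Set.Icc a b, w s = w u) :
    ∃ w' : ℝ → ℝ,
      (∀ r ∈ Set.Icc (0 : ℝ) 1, w r = ((w' r : ℝ) : EReal)) ∧
      (∀ s t : ℝ, s ∈ Set.Icc (0 : ℝ) 1 → t ∈ Set.Icc (0 : ℝ) 1 → s ≤ t →
        |w' t - w' s| ≤ 2 * (∫⁻ r in Set.Icc s t, g r * ENNReal.ofReal (L r)).toReal) ∧
      ∃ h : ℝ → ℝ, IntegrableOn h (Set.Icc (0 : ℝ) 1) ∧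
        ∀ r ∈ Set.Icc (0 : ℝ) 1, w' r = w' 0 + ∫ u in (0 : ℝ)..r, h u := by
  have hLii : ∀ a ∈ Set.Icc (0 : ℝ) 1, ∀ b ∈ Set.Icc (0 : ℝ) 1, IntervalIntegrable L volume a b := by
    intro a ha b hb
    refine (hLint.mono_set ?_).intervalIntegrable
    exact Set.uIcc_subset_Icc ha hb
  have h0 : (0 : ℝ) ∈ Set.Icc (0 : ℝ) 1 := ⟨le_rfl, zero_le_one⟩
  have h1 : (1 : ℝ) ∈ Set.Icc (0 : ℝ) 1 := ⟨zero_le_one, le_rfl⟩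
  set l : ℝ → ℝ := fun x => ∫ r in (0 : ℝ)..x, L r with hl
  have hlsub : ∀ a ∈ Set.Icc (0 : ℝ) 1, ∀ b ∈ Set.Icc (0 : ℝ) 1, ∫ r in a..b, L r = l b - l a := by
    intro a ha b hb
    rw [hl]
    exact (intervalIntegral.integral_interval_sub_left (hLii 0 h0 b hb) (hLii 0 h0 a ha)).symm
  have hlc : ContinuousOn l (Set.Icc (0 : ℝ) 1) :=
    intervalIntegral.continuousOn_primitive_interval (by rwa [Set.uIcc_of_le zero_le_one])
      |>.mono (by rw [Set.uIcc_of_le zero_le_one])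
  have hlm : MonotoneOn l (Set.Icc (0 : ℝ) 1) := by
    intro a ha b hb hab
    rw [← sub_nonneg, ← hlsub a ha b hb]
    exact intervalIntegral.integral_nonneg hab
      fun u hu => hL0 u ⟨ha.1.trans hu.1, hu.2.trans hb.2⟩
  -- the real density
  set k : ℝ → ℝ := fun r => (g r * ENNReal.ofReal (L r)).toReal with hk
  have hGm : AEMeasurable (fun r => g r * ENNReal.ofReal (L r))
      (volume.restrict (Set.Icc (0 : ℝ) 1)) :=
    hg.aemeasurable.mul hLint.aemeasurable.ennreal_ofReal
  have hkint : IntegrableOn k (Set.Icc (0 : ℝ) 1) := integrable_toReal_of_lintegral_ne_top hGm hgL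
  have hkii : ∀ a ∈ Set.Icc (0 : ℝ) 1, ∀ b ∈ Set.Icc (0 : ℝ) 1, IntervalIntegrable k volume a b := by
    intro a ha b hb
    refine (hkint.mono_set ?_).intervalIntegrable
    exact Set.uIcc_subset_Icc ha hb
  set Φ : ℝ → ℝ := fun x => ∫ r in (0 : ℝ)..x, k r with hΦ
  have hJ : ∀ a b, 0 ≤ a → a ≤ b → b ≤ 1 →
      (∫⁻ r in Set.Icc a b, g r * ENNReal.ofReal (L r)) ≠ ⊤ ∧
      (∫⁻ r in Set.Icc a b, g r * ENNReal.ofReal (L r)).toReal = Φ b - Φ a := by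
    intro a b ha hab hb
    have hsub : Set.Icc a b ⊆ Set.Icc (0 : ℝ) 1 := Set.Icc_subset_Icc ha hb
    have hfin : (∫⁻ r in Set.Icc a b, g r * ENNReal.ofReal (L r)) ≠ ⊤ :=
      ne_top_of_le_ne_top hgL (lintegral_mono_set hsub)
    refine ⟨hfin, ?_⟩
    rw [hΦ]
    simp only
    rw [intervalIntegral.integral_interval_sub_left (hkii 0 h0 b ⟨ha.trans hab, hb⟩)
      (hkii 0 h0 a ⟨ha, hab.trans hb⟩), intervalIntegral.integral_of_le hab,
      ← integral_Icc_eq_integral_Ioc, hk]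
    have hm := hGm.mono_measure (Measure.restrict_mono hsub le_rfl)
    rw [integral_toReal hm (ae_lt_top' hm hfin)]
  have hΦm : MonotoneOn Φ (Set.Icc (0 : ℝ) 1) := by
    intro a ha b hb hab
    rw [← sub_nonneg, ← (hJ a b ha.1 hab hb.2).2]
    exact ENNReal.toReal_nonneg
  have hpick : ∀ a b, 0 ≤ a → a ≤ b → b ≤ 1 → l a < l b → ∃ τ ∈ Set.Icc a b, w τ ≠ ⊥ ∧
      g τ * ENNReal.ofReal (l b - l a) ≤ ENNReal.ofReal (Φ b - Φ a) := by
    intro a b ha hab hb hlt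
    have e := hlsub a ⟨ha, hab.trans hb⟩ b ⟨ha.trans hab, hb⟩
    obtain ⟨τ, hτ, hτ2, hτ3⟩ := acc_pick L hL0 hLint g hg w hae ha hab hb (by rw [e]; linarith)
    refine ⟨τ, hτ, hτ2, ?_⟩
    rw [← (hJ a b ha hab hb).2, ENNReal.ofReal_toReal (hJ a b ha hab hb).1, ← e]
    exact hτ3
  have hmain' : ∀ t ∈ Set.Icc (0 : ℝ) 1, w t ≠ ⊥ → ∀ s ∈ Set.Icc (0 : ℝ) 1,
      w s - w t ≤ (g t : EReal) * ((ENNReal.ofReal |l t - l s| : ℝ≥0∞) : EReal) := by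
    intro t ht hwt s hs
    rw [← hlsub s hs t ht]
    exact hmain t ht hwt s hs
  have hconst' : ∀ a ∈ Set.Icc (0 : ℝ) 1, ∀ b ∈ Set.Icc (0 : ℝ) 1, l a = l b → w a = w b := by
    intro a ha b hb hab
    rcases le_total a b with h | h
    · exact hconst a b ha hb h (by rw [hlsub a ha b hb]; linarith) a ⟨le_rfl, h⟩ b ⟨h, le_rfl⟩
    · exact hconst b a hb ha h (by rw [hlsub b hb a ha]; linarith) a ⟨h, le_rfl⟩ b ⟨le_rfl, h⟩
  -- two-sided transfer
  have trans : ∀ s ∈ Set.Icc (0 : ℝ) 1, ∀ t ∈ Set.Icc (0 : ℝ) 1, s ≤ t → ∀ c : ℝ,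
      ((c : EReal) ≤ w t → ((c - 2 * (Φ t - Φ s) : ℝ) : EReal) ≤ w s) ∧
      ((c : EReal) ≤ w s → ((c - 2 * (Φ t - Φ s) : ℝ) : EReal) ≤ w t) := by
    intro s hs t ht hst c
    rcases (hlm hs ht hst).eq_or_lt with heq | hlt
    · have hw := hconst' s hs t ht heq
      have hΦ0 := hΦm hs ht hst
      have hle : ((c - 2 * (Φ t - Φ s) : ℝ) : EReal) ≤ (c : EReal) := by
        rw [EReal.coe_le_coe_iff]; linarith
      exact ⟨fun h => by rw [hw]; exact hle.trans h, fun h => by rw [← hw]; exact hle.trans h⟩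
    · have hch := acc_exists hlc hlm hΦm hpick hs ht hst hlt
      exact ⟨fun h => acc_main hwtop husc hlc hmain' hconst' hs ht hch h,
        fun h => acc_main hwtop husc hlc hmain' hconst' ht hs hch.symm h⟩
  -- finiteness
  obtain ⟨τ, hτ, hτ2, -⟩ := hpick 0 1 le_rfl zero_le_one le_rfl (by
    rw [← sub_pos, ← hlsub 0 h0 1 h1]; exact hLpos)
  have hfin : ∀ r ∈ Set.Icc (0 : ℝ) 1, w r ≠ ⊥ := by
    intro r hr hbot
    have e : (((w τ).toReal : ℝ) : EReal) ≤ w τ := (EReal.coe_toReal (hwtop τ) hτ2).le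
    rcases le_total r τ with h | h
    · have := (trans r hr τ hτ h _).1 e
      rw [hbot] at this
      exact EReal.coe_ne_bot _ (le_bot_iff.1 this)
    · have := (trans τ hτ r hr h _).2 e
      rw [hbot] at this
      exact EReal.coe_ne_bot _ (le_bot_iff.1 this)
  have hw' : ∀ r ∈ Set.Icc (0 : ℝ) 1, w r = (((w r).toReal : ℝ) : EReal) := fun r hr =>
    (EReal.coe_toReal (hwtop r) (hfin r hr)).symm
  have hbd : ∀ s t : ℝ, s ∈ Set.Icc (0 : ℝ) 1 → t ∈ Set.Icc (0 : ℝ) 1 → s ≤ t →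
      |(w t).toReal - (w s).toReal| ≤ 2 * (Φ t - Φ s) := by
    intro s t hs ht hst
    have a1 := (trans s hs t ht hst _).1 (hw' t ht).ge
    have a2 := (trans s hs t ht hst _).2 (hw' s hs).ge
    rw [hw' s hs, EReal.coe_le_coe_iff] at a1
    rw [hw' t ht, EReal.coe_le_coe_iff] at a2
    rw [abs_le]; constructor <;> linarith
  refine ⟨fun r => (w r).toReal, hw', ?_, acc_ac hkint hbd⟩
  intro s t hs ht hst
  rw [(hJ s t hs.1 hst ht.2).2]
  exact hbd s t hs ht hst
end

section
/- Convexity of the squared Wasserstein slope of the entropy: for μ₁, μ₂ ∈ D(Ent_m) with finite descending slope and α₁,α₂ ∈ (0,1), α₁+α₂ = 1, the measure μ = α₁μ₁ + α₂μ₂ satisfies |∇⁻Ent_m|²(μ) ≤ α₁|∇⁻Ent_m|²(μ₁) + α₂|∇⁻Ent_m|²(μ₂). -/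
open Filter Topology MeasureTheory
open scoped ENNReal NNReal

/-- The relative entropy `Ent(μ|m) = ∫ ρ log ρ dm` where `ρ = dμ/dm`
(a Bochner integral, junk value `0` if the integrand is not integrable). -/
noncomputable def relEnt {X : Type*} [MeasurableSpace X] (m μ : Measure X) : ℝ :=
  ∫ x, (μ.rnDeriv m x).toReal * Real.log ((μ.rnDeriv m x).toReal) ∂m

/-- `μ` belongs to the domain of the relative entropy w.r.t. `m`: it is a probability
measure, absolutely continuous w.r.t. `m`, with `ρ log ρ ∈ L¹(m)`. -/
def MemEntDom {X : Type*} [MeasurableSpace X] (m μ : Measure X) : Prop :=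
  IsProbabilityMeasure μ ∧ μ ≪ m ∧
    Integrable (fun x => (μ.rnDeriv m x).toReal * Real.log ((μ.rnDeriv m x).toReal)) m

/-- The squared quadratic Kantorovich-Wasserstein distance: the infimal transport cost
`∫ d² dπ` over couplings `π` of `μ` and `ν`. -/
noncomputable def W2sq {X : Type*} [MetricSpace X] [MeasurableSpace X]
    (μ ν : Measure X) : ℝ≥0∞ :=
  ⨅ (π : Measure (X × X)) (_ : π.map Prod.fst = μ ∧ π.map Prod.snd = ν),
    ∫⁻ p, edist p.1 p.2 ^ 2 ∂π

/-- The quadratic Kantorovich-Wasserstein distance. -/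
noncomputable def W2 {X : Type*} [MetricSpace X] [MeasurableSpace X]
    (μ ν : Measure X) : ℝ≥0∞ :=
  W2sq μ ν ^ (1 / 2 : ℝ)

/-- The descending slope of the relative entropy in the Wasserstein space:
`|∇⁻Ent_m|(μ) = limsup_{ν→μ in W₂} (Ent_m(μ) - Ent_m(ν))⁺ / W₂(μ,ν)` (measures outside
the entropy domain do not contribute, since there `Ent_m = +∞`). -/
noncomputable def entDescSlope {X : Type*} [MetricSpace X] [MeasurableSpace X]
    (m μ : Measure X) : ℝ≥0∞ :=
  ⨅ (ε : ℝ≥0∞) (_ : 0 < ε),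
    ⨆ (ν : Measure X) (_ : MemEntDom m ν ∧ 0 < W2 μ ν ∧ W2 μ ν < ε),
      ENNReal.ofReal (relEnt m μ - relEnt m ν) / W2 μ ν


/-- `μ` has the nonnegative real density `ρ` with respect to `m`. -/
def HasDens {X : Type*} [MeasurableSpace X] (m μ : Measure X) (ρ : X → ℝ) : Prop :=
  Measurable ρ ∧ (∀ x, 0 ≤ ρ x) ∧ μ = m.withDensity (fun x => ENNReal.ofReal (ρ x))

/-- `μ` has a density with respect to `m`. -/
def Dec {X : Type*} [MeasurableSpace X] (m μ : Measure X) : Prop := ∃ ρ, HasDens m μ ρ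

section dens
variable {X : Type*} [MeasurableSpace X] {m μ ν : Measure X} {ρ : X → ℝ}

lemma HasDens.ac (h : HasDens m μ ρ) : μ ≪ m := by
  rw [h.2.2]; exact withDensity_absolutelyContinuous _ _

lemma HasDens.lintegral [IsFiniteMeasure μ] (h : HasDens m μ ρ) :
    ∫⁻ x, ENNReal.ofReal (ρ x) ∂m ≠ ⊤ := by
  have : μ Set.univ ≠ ⊤ := measure_ne_top _ _
  rwa [h.2.2, withDensity_apply _ MeasurableSet.univ, setLIntegral_univ] at this

lemma HasDens.integrable [IsFiniteMeasure μ] (h : HasDens m μ ρ) : Integrable ρ m := by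
  refine ⟨h.1.aestronglyMeasurable, ?_⟩
  rw [hasFiniteIntegral_iff_ofReal (Eventually.of_forall h.2.1)]
  exact lt_top_iff_ne_top.2 h.lintegral

lemma HasDens.integral_eq (h : HasDens m μ ρ) (g : X → ℝ) :
    ∫ x, g x ∂μ = ∫ x, ρ x * g x ∂m := by
  rw [h.2.2, integral_withDensity_eq_integral_toReal_smul h.1.ennreal_ofReal (by simp)]
  simp [ENNReal.toReal_ofReal (h.2.1 _)]

lemma HasDens.integrable_iff (h : HasDens m μ ρ) (g : X → ℝ) :
    Integrable g μ ↔ Integrable (fun x => ρ x * g x) m := by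
  rw [h.2.2, integrable_withDensity_iff_integrable_smul' h.1.ennreal_ofReal (by simp)]
  simp [ENNReal.toReal_ofReal (h.2.1 _)]

lemma withDensity_rnDeriv_of_ac [IsFiniteMeasure μ] (hac : μ ≪ m)
    (hd : μ.HaveLebesgueDecomposition m) : m.withDensity (μ.rnDeriv m) = μ := by
  have h := Measure.haveLebesgueDecomposition_add μ m
  have h0 : μ.singularPart m = 0 := by
    have h1 := Measure.mutuallySingular_singularPart μ m
    have h2 : μ.singularPart m ≪ m :=
      (Measure.absolutelyContinuous_of_le (Measure.singularPart_le μ m)).trans hac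
    exact Measure.eq_zero_of_absolutelyContinuous_of_mutuallySingular h2 h1
  rw [h0, zero_add] at h
  exact h.symm

lemma HasDens.rnDeriv [IsFiniteMeasure μ] (h : HasDens m μ ρ) :
    (fun x => (μ.rnDeriv m x).toReal) =ᵐ[m] ρ := by
  have hd : μ.HaveLebesgueDecomposition m := by
    rw [h.2.2]; exact Measure.haveLebesgueDecomposition_withDensity m h.1.ennreal_ofReal
  have h1 := withDensity_rnDeriv_of_ac h.ac hd
  have h2 : m.withDensity (fun x => ENNReal.ofReal (ρ x)) = m.withDensity (μ.rnDeriv m) := by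
    rw [h1]; exact h.2.2.symm
  rw [withDensity_eq_iff h.1.ennreal_ofReal.aemeasurable
    (Measure.measurable_rnDeriv _ _).aemeasurable h.lintegral] at h2
  filter_upwards [h2] with x hx
  rw [← hx, ENNReal.toReal_ofReal (h.2.1 x)]

lemma HasDens.relEnt_eq [IsFiniteMeasure μ] (h : HasDens m μ ρ) :
    relEnt m μ = ∫ x, ρ x * Real.log (ρ x) ∂m := by
  unfold relEnt
  refine integral_congr_ae ?_
  filter_upwards [h.rnDeriv] with x hx
  rw [hx]

lemma HasDens.memEntDom_iff [IsProbabilityMeasure μ] (h : HasDens m μ ρ) :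
    MemEntDom m μ ↔ Integrable (fun x => ρ x * Real.log (ρ x)) m := by
  unfold MemEntDom
  rw [integrable_congr (g := fun x => ρ x * Real.log (ρ x))]
  · exact ⟨fun h => h.2.2, fun h' => ⟨inferInstance, h.ac, h'⟩⟩
  · filter_upwards [h.rnDeriv] with x hx
    rw [hx]

lemma dec_of_withDensity [IsFiniteMeasure μ] {f : X → ℝ≥0∞} (hf : Measurable f)
    (h : μ = m.withDensity f) : Dec m μ := by
  refine ⟨fun x => (f x).toReal, hf.ennreal_toReal, fun x => ENNReal.toReal_nonneg, ?_⟩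
  rw [h]
  have hfin : ∫⁻ x, f x ∂m ≠ ⊤ := by
    have : μ Set.univ ≠ ⊤ := measure_ne_top _ _
    rwa [h, withDensity_apply _ MeasurableSet.univ, setLIntegral_univ] at this
  refine withDensity_congr_ae ?_
  filter_upwards [ae_lt_top hf hfin] with x hx
  rw [ENNReal.ofReal_toReal hx.ne]

lemma dec_iff [IsFiniteMeasure μ] (hac : μ ≪ m) :
    Dec m μ ↔ μ.HaveLebesgueDecomposition m := by
  constructor
  · rintro ⟨ρ, h⟩
    rw [h.2.2]; exact Measure.haveLebesgueDecomposition_withDensity m h.1.ennreal_ofReal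
  · intro hd
    exact dec_of_withDensity (Measure.measurable_rnDeriv _ _) (withDensity_rnDeriv_of_ac hac hd).symm

lemma not_dec_relEnt [IsFiniteMeasure μ] (hac : μ ≪ m) (h : ¬ Dec m μ) : relEnt m μ = 0 := by
  rw [dec_iff hac] at h
  simp [relEnt, Measure.rnDeriv_of_not_haveLebesgueDecomposition h]

lemma not_dec_memEntDom [IsProbabilityMeasure μ] (hac : μ ≪ m) (h : ¬ Dec m μ) :
    MemEntDom m μ := by
  rw [dec_iff hac] at h
  refine ⟨inferInstance, hac, ?_⟩
  simp [Measure.rnDeriv_of_not_haveLebesgueDecomposition h]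

lemma Dec.of_ac [IsFiniteMeasure μ] [IsFiniteMeasure ν] (h : Dec m μ) (hac : ν ≪ μ) :
    Dec m ν := by
  obtain ⟨ρ, h⟩ := h
  refine dec_of_withDensity (f := (fun x => ENNReal.ofReal (ρ x)) * ν.rnDeriv μ)
    (h.1.ennreal_ofReal.mul (Measure.measurable_rnDeriv _ _)) ?_
  rw [withDensity_mul _ h.1.ennreal_ofReal (Measure.measurable_rnDeriv _ _), ← h.2.2,
    Measure.withDensity_rnDeriv_eq _ _ hac]

lemma Dec.add [IsFiniteMeasure μ] [IsFiniteMeasure ν] (h : Dec m μ) (h' : Dec m ν) :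
    Dec m (μ + ν) := by
  obtain ⟨ρ, h⟩ := h
  obtain ⟨ρ', h'⟩ := h'
  refine dec_of_withDensity (h.1.ennreal_ofReal.add h'.1.ennreal_ofReal) ?_
  rw [withDensity_add_left h.1.ennreal_ofReal, ← h.2.2, ← h'.2.2]

/-- A splitting of a finite measure into two pieces is given by a density `u ∈ [0,1]`. -/
lemma exists_split {μ σ σ' : Measure X} [IsFiniteMeasure μ] (h : σ + σ' = μ) :
    ∃ u : X → ℝ, Measurable u ∧ (∀ x, 0 ≤ u x ∧ u x ≤ 1) ∧
      σ = μ.withDensity (fun x => ENNReal.ofReal (u x)) ∧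
      σ' = μ.withDensity (fun x => ENNReal.ofReal (1 - u x)) := by
  have hle : σ ≤ μ := by rw [← h]; exact Measure.le_add_right le_rfl
  have hle' : σ' ≤ μ := by rw [← h]; exact Measure.le_add_left le_rfl
  have : IsFiniteMeasure σ := isFiniteMeasure_of_le μ hle
  have : IsFiniteMeasure σ' := isFiniteMeasure_of_le μ hle'
  have hu : Measurable fun x => min (σ.rnDeriv μ x).toReal 1 :=
    (Measure.measurable_rnDeriv _ _).ennreal_toReal.min measurable_const
  have hu1 : ∀ x, 0 ≤ min (σ.rnDeriv μ x).toReal 1 ∧ min (σ.rnDeriv μ x).toReal 1 ≤ 1 :=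
    fun x => ⟨le_min ENNReal.toReal_nonneg zero_le_one, min_le_right _ _⟩
  have h1 : σ = μ.withDensity (fun x => ENNReal.ofReal (min (σ.rnDeriv μ x).toReal 1)) := by
    conv_lhs => rw [← Measure.withDensity_rnDeriv_eq _ _ (Measure.absolutelyContinuous_of_le hle)]
    refine withDensity_congr_ae ?_
    filter_upwards [Measure.rnDeriv_le_one_of_le hle] with x hx
    have hx' : σ.rnDeriv μ x ≤ 1 := hx
    have hne : σ.rnDeriv μ x ≠ ⊤ := (hx'.trans_lt ENNReal.one_lt_top).ne
    rw [min_eq_left, ENNReal.ofReal_toReal hne]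
    simpa using ENNReal.toReal_mono ENNReal.one_ne_top hx'
  refine ⟨_, hu, hu1, h1, ?_⟩
  have h2 : μ.withDensity (fun x => ENNReal.ofReal (1 - min (σ.rnDeriv μ x).toReal 1)) + σ
      = σ' + σ := by
    set w : X → ℝ := fun x => min (σ.rnDeriv μ x).toReal 1 with hw
    have h1' : σ = μ.withDensity (fun x => ENNReal.ofReal (w x)) := h1
    change μ.withDensity (fun x => ENNReal.ofReal (1 - w x)) + σ = σ' + σ
    have hu1 : ∀ x, 0 ≤ w x ∧ w x ≤ 1 := hu1
    clear_value w
    conv_lhs => rw [h1']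
    rw [← withDensity_add_right _ hu.ennreal_ofReal, add_comm σ' σ, h]
    conv_rhs => rw [← withDensity_one (μ := μ)]
    congr 1
    ext x
    simp only [Pi.add_apply, Pi.one_apply]
    rw [← ENNReal.ofReal_add (by linarith [(hu1 x).2]) (hu1 x).1]
    simp
  ext s hs
  have h3 := congrArg (fun μ : Measure X => μ s) h2
  simp only [Measure.add_apply] at h3
  exact ((ENNReal.add_left_inj (measure_ne_top σ s)).1 h3).symm

/-- The density of a piece. -/
lemma HasDens.piece {σ : Measure X} {u : X → ℝ} {a : ℝ} (ha : 0 < a)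
    (h : HasDens m μ ρ) (hu : Measurable u) (hu0 : ∀ x, 0 ≤ u x)
    (hs : ENNReal.ofReal a • σ = μ.withDensity (fun x => ENNReal.ofReal (u x))) :
    HasDens m σ (fun x => u x * ρ x / a) := by
  refine ⟨(hu.mul h.1).div_const _, fun x => div_nonneg (mul_nonneg (hu0 x) (h.2.1 x)) ha.le, ?_⟩
  have ha' : ENNReal.ofReal a ≠ 0 := by simpa using ha
  have h1 : σ = (ENNReal.ofReal a)⁻¹ • (ENNReal.ofReal a • σ) := by
    rw [smul_smul, ENNReal.inv_mul_cancel ha' ENNReal.ofReal_ne_top, one_smul]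
  rw [h1, hs, h.2.2, ← withDensity_mul _ h.1.ennreal_ofReal hu.ennreal_ofReal,
    ← withDensity_smul _ (h.1.ennreal_ofReal.mul hu.ennreal_ofReal)]
  congr 1
  ext x
  simp only [Pi.smul_apply, Pi.mul_apply, smul_eq_mul]
  rw [ENNReal.ofReal_div_of_pos ha, ENNReal.ofReal_mul (hu0 x), div_eq_mul_inv]
  ring

lemma piece_aux (a u r : ℝ) (ha : 0 < a) :
    a * ((u * r / a) * Real.log (u * r / a)) =
      r * (u * Real.log u) + u * (r * Real.log r) - Real.log a * (u * r) := by
  by_cases hu : u = 0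
  · simp [hu]
  by_cases hr : r = 0
  · simp [hr]
  rw [Real.log_div (mul_ne_zero hu hr) ha.ne', Real.log_mul hu hr]
  field_simp

lemma split_aux (a b u r : ℝ) (ha : 0 < a) (hb : 0 < b) :
    a * ((u * r / a) * Real.log (u * r / a)) + b * (((1-u) * r / b) * Real.log ((1-u) * r / b)) =
      r * Real.log r - r * Real.binEntropy u - (Real.log a * (u * r) + Real.log b * ((1-u) * r)) := by
  rw [piece_aux _ _ _ ha, piece_aux _ _ _ hb, Real.binEntropy_eq_negMulLog_add_negMulLog_one_sub]
  simp only [Real.negMulLog]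
  ring

/-- Bounded measurable functions are integrable. -/
lemma bdd_integrable [IsFiniteMeasure μ] {u : X → ℝ} (hu : Measurable u) (C : ℝ)
    (h : ∀ x, |u x| ≤ C) : Integrable u μ :=
  Integrable.of_bound hu.aestronglyMeasurable C (Eventually.of_forall h)

lemma binEntropy_abs_le {u : ℝ} (h : 0 ≤ u ∧ u ≤ 1) : |Real.binEntropy u| ≤ Real.log 2 := by
  rw [abs_of_nonneg (Real.binEntropy_nonneg h.1 h.2)]
  exact Real.binEntropy_le_log_two

structure SplitData (μ μ₁ μ₂ : Measure X) (a₁ a₂ : ℝ) (u : X → ℝ) : Prop where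
  meas : Measurable u
  bd : ∀ x, 0 ≤ u x ∧ u x ≤ 1
  e₁ : ENNReal.ofReal a₁ • μ₁ = μ.withDensity (fun x => ENNReal.ofReal (u x))
  e₂ : ENNReal.ofReal a₂ • μ₂ = μ.withDensity (fun x => ENNReal.ofReal (1 - u x))

lemma SplitData.int_u {μ μ₁ μ₂ : Measure X} {a₁ a₂ : ℝ} {u : X → ℝ} (h : SplitData μ μ₁ μ₂ a₁ a₂ u)
    [IsProbabilityMeasure μ] [IsProbabilityMeasure μ₁] (ha₁ : 0 < a₁) :
    ∫ x, u x ∂μ = a₁ := by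
  have h1 := congrArg (fun ν : Measure X => ν Set.univ) h.e₁
  simp only [Measure.smul_apply, measure_univ, smul_eq_mul, mul_one] at h1
  rw [withDensity_apply _ MeasurableSet.univ, setLIntegral_univ] at h1
  rw [integral_eq_lintegral_of_nonneg_ae (Eventually.of_forall fun x => (h.bd x).1)
    h.meas.aestronglyMeasurable, ← h1, ENNReal.toReal_ofReal ha₁.le]

lemma SplitData.entropy {μ μ₁ μ₂ : Measure X} {a₁ a₂ : ℝ} {u : X → ℝ}
    (h : SplitData μ μ₁ μ₂ a₁ a₂ u)
    [IsProbabilityMeasure μ] [IsProbabilityMeasure μ₁] [IsProbabilityMeasure μ₂]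
    (ha₁ : 0 < a₁) (ha₂ : 0 < a₂) (hsum : a₁ + a₂ = 1) (hd : Dec m μ) :
    (MemEntDom m μ ↔ MemEntDom m μ₁ ∧ MemEntDom m μ₂) ∧
    (MemEntDom m μ → a₁ * relEnt m μ₁ + a₂ * relEnt m μ₂ =
      relEnt m μ + Real.binEntropy a₁ - ∫ x, Real.binEntropy (u x) ∂μ) := by
  obtain ⟨ρ, hρ⟩ := hd
  have hu1 : Measurable fun x => 1 - u x := measurable_const.sub h.meas
  have hd1 := hρ.piece ha₁ h.meas (fun x => (h.bd x).1) h.e₁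
  have hd2 := hρ.piece ha₂ hu1 (fun x => by linarith [(h.bd x).2]) h.e₂
  have iu : Integrable u μ := bdd_integrable h.meas 1 fun x => by
    rw [abs_of_nonneg (h.bd x).1]; exact (h.bd x).2
  have iu' : Integrable (fun x => 1 - u x) μ := (integrable_const 1).sub iu
  have hbm : Measurable fun x => Real.binEntropy (u x) :=
    Real.binEntropy_continuous.measurable.comp h.meas
  have ib : Integrable (fun x => Real.binEntropy (u x)) μ :=
    bdd_integrable hbm (Real.log 2) fun x => binEntropy_abs_le (h.bd x)
  have iul : Integrable (fun x => u x * Real.log (u x)) μ :=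
    bdd_integrable (h.meas.mul (Real.measurable_log.comp h.meas)) 1 fun x => by
      rcases (h.bd x).1.eq_or_lt with h0 | h0
      · simp [← h0]
      · rw [mul_comm]; exact (Real.abs_log_mul_self_lt _ h0 (h.bd x).2).le
  have iul' : Integrable (fun x => (1 - u x) * Real.log (1 - u x)) μ :=
    bdd_integrable (hu1.mul (Real.measurable_log.comp hu1)) 1 fun x => by
      rcases (h.bd x).2.eq_or_lt with h0 | h0
      · simp [h0]
      · rw [mul_comm]
        exact (Real.abs_log_mul_self_lt _ (by linarith) (by linarith [(h.bd x).1])).le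
  have ju := (hρ.integrable_iff _).1 iu
  have ju' := (hρ.integrable_iff _).1 iu'
  have jb := (hρ.integrable_iff _).1 ib
  have jul := (hρ.integrable_iff _).1 iul
  have jul' := (hρ.integrable_iff _).1 iul'
  have eu := hρ.integral_eq u
  have eu' := hρ.integral_eq (fun x => 1 - u x)
  have eb := hρ.integral_eq (fun x => Real.binEntropy (u x))
  have hiu := h.int_u ha₁
  have hiu' : ∫ x, (1 - u x) ∂μ = a₂ := by
    rw [integral_sub (integrable_const 1) iu, hiu]; simp; linarith
  have hiff : MemEntDom m μ ↔ MemEntDom m μ₁ ∧ MemEntDom m μ₂ := by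
    rw [hρ.memEntDom_iff, hd1.memEntDom_iff, hd2.memEntDom_iff]
    constructor
    · intro hi
      have k1 : Integrable (fun x => u x * (ρ x * Real.log (ρ x))) m :=
        hi.bdd_mul (c := 1) h.meas.aestronglyMeasurable (Eventually.of_forall fun x => by
          rw [Real.norm_eq_abs, abs_of_nonneg (h.bd x).1]; exact (h.bd x).2)
      have k2 : Integrable (fun x => (1 - u x) * (ρ x * Real.log (ρ x))) m :=
        hi.bdd_mul (c := 1) hu1.aestronglyMeasurable (Eventually.of_forall fun x => by
          rw [Real.norm_eq_abs, abs_of_nonneg (by linarith [(h.bd x).2])]; linarith [(h.bd x).1])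
      constructor
      · refine (((jul.add k1).sub (ju.const_mul (Real.log a₁))).const_mul a₁⁻¹).congr
          (Eventually.of_forall fun x => ?_)
        have := piece_aux a₁ (u x) (ρ x) ha₁
        simp only [Pi.add_apply, Pi.sub_apply]
        rw [inv_mul_eq_div, div_eq_iff ha₁.ne']
        linarith
      · refine (((jul'.add k2).sub (ju'.const_mul (Real.log a₂))).const_mul a₂⁻¹).congr
          (Eventually.of_forall fun x => ?_)
        have := piece_aux a₂ (1 - u x) (ρ x) ha₂
        simp only [Pi.add_apply, Pi.sub_apply]
        rw [inv_mul_eq_div, div_eq_iff ha₂.ne']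
        linarith
    · rintro ⟨i1, i2⟩
      refine ((((i1.const_mul a₁).add (i2.const_mul a₂)).add jb).add
        ((ju.const_mul (Real.log a₁)).add (ju'.const_mul (Real.log a₂)))).congr
          (Eventually.of_forall fun x => ?_)
      have := split_aux a₁ a₂ (u x) (ρ x) ha₁ ha₂
      simp only [Pi.add_apply]
      linarith
  refine ⟨hiff, fun hm => ?_⟩
  have i0 := hρ.memEntDom_iff.1 hm
  have i1 := hd1.memEntDom_iff.1 (hiff.1 hm).1
  have i2 := hd2.memEntDom_iff.1 (hiff.1 hm).2
  rw [hρ.relEnt_eq, hd1.relEnt_eq, hd2.relEnt_eq, ← integral_const_mul, ← integral_const_mul,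
    ← integral_add (i1.const_mul _) (i2.const_mul _)]
  simp_rw [split_aux a₁ a₂ _ _ ha₁ ha₂]
  have jl : Integrable (fun x => Real.log a₁ * (u x * ρ x)) m := by
    simpa only [mul_comm] using ju.const_mul (Real.log a₁)
  have jl' : Integrable (fun x => Real.log a₂ * ((1 - u x) * ρ x)) m := by
    simpa only [mul_comm] using ju'.const_mul (Real.log a₂)
  have js : Integrable (fun x => ρ x * Real.log (ρ x) - ρ x * Real.binEntropy (u x)) m := i0.sub jb
  have js' : Integrable (fun x => Real.log a₁ * (u x * ρ x) + Real.log a₂ * ((1 - u x) * ρ x)) m :=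
    jl.add jl'
  rw [integral_sub js js', integral_sub i0 jb, integral_add jl jl',
    integral_const_mul, integral_const_mul, ← eb]
  have e1 : ∫ x, u x * ρ x ∂m = a₁ := by
    rw [← hiu, eu]; simp only [mul_comm]
  have e2 : ∫ x, (1 - u x) * ρ x ∂m = a₂ := by
    rw [← hiu', eu']; simp only [mul_comm]
  rw [e1, e2, Real.binEntropy_eq_negMulLog_add_negMulLog_one_sub]
  have : 1 - a₁ = a₂ := by linarith
  rw [this]
  simp only [Real.negMulLog]
  ring

end dens

lemma gibbs {u w : ℝ} (h0 : 0 ≤ u) (h1 : u ≤ 1) (hw0 : 0 < w) (hw1 : w < 1) :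
    Real.binEntropy u ≤ -(u * Real.log w) - (1 - u) * Real.log (1 - w) := by
  have key : ∀ {s t : ℝ}, 0 ≤ s → 0 < t → Real.negMulLog s ≤ -(s * Real.log t) + (t - s) := by
    intro s t hs ht
    rcases hs.eq_or_lt with h | h
    · subst h; simp; exact ht.le
    · have := Real.log_le_sub_one_of_pos (div_pos ht h)
      rw [Real.log_div ht.ne' h.ne'] at this
      have h2 := mul_le_mul_of_nonneg_left this hs
      have h3 : s * (t / s - 1) = t - s := by field_simp
      rw [h3] at h2
      simp only [Real.negMulLog]
      nlinarith
  rw [Real.binEntropy_eq_negMulLog_add_negMulLog_one_sub]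
  have k1 := key h0 hw0
  have k2 := key (sub_nonneg.2 h1) (sub_pos.2 hw1)
  linarith

lemma gibbs' {v c η w : ℝ} (h0 : 0 ≤ v) (hc : 0 < c) (hcη : Real.log c = -η)
    (hw : c * v ≤ w) : -(v * Real.log w) ≤ Real.negMulLog v + v * η := by
  rcases h0.eq_or_lt with h | h
  · subst h; simp
  · have : Real.log (c * v) ≤ Real.log w := Real.log_le_log (mul_pos hc h) hw
    rw [Real.log_mul hc.ne' h.ne', hcη] at this
    simp only [Real.negMulLog]
    nlinarith

section coup
variable {X : Type*} [MeasurableSpace X]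

def IsCoup (π : Measure (X × X)) (μ ν : Measure X) : Prop :=
  π.map Prod.fst = μ ∧ π.map Prod.snd = ν

lemma IsCoup.prob {π : Measure (X × X)} {μ ν : Measure X} [IsProbabilityMeasure μ]
    (h : IsCoup π μ ν) : IsProbabilityMeasure π := by
  constructor
  have h1 : μ Set.univ = 1 := measure_univ
  rwa [← h.1, Measure.map_apply measurable_fst MeasurableSet.univ, Set.preimage_univ] at h1

lemma jensen {π : Measure (X × X)} {μ ν σ σ' : Measure X} [IsProbabilityMeasure μ]
    [IsProbabilityMeasure ν] (hπ : IsCoup π μ ν) {u v : X → ℝ}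
    (hu : Measurable u) (hub : ∀ x, 0 ≤ u x ∧ u x ≤ 1)
    (hv : Measurable v) (hvb : ∀ x, 0 ≤ v x ∧ v x ≤ 1)
    (h1 : (π.withDensity (fun p => ENNReal.ofReal (u p.1))).map Prod.snd = σ)
    (h2 : (π.withDensity (fun p => ENNReal.ofReal (1 - u p.1))).map Prod.snd = σ')
    (h1' : σ = ν.withDensity (fun x => ENNReal.ofReal (v x)))
    (h2' : σ' = ν.withDensity (fun x => ENNReal.ofReal (1 - v x))) :
    ∫ x, Real.binEntropy (u x) ∂μ ≤ ∫ x, Real.binEntropy (v x) ∂ν := by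
  have := hπ.prob
  refine le_of_forall_pos_le_add fun η hη => ?_
  set c := Real.exp (-η) with hc
  have hc0 : 0 < c := Real.exp_pos _
  have hc1 : c < 1 := by rw [hc]; simpa using hη
  have hlc : Real.log c = -η := by rw [hc, Real.log_exp]
  let w : X → ℝ := fun y => c * v y + (1 - c) / 2
  have hwm : Measurable w := (hv.const_mul _).add_const _
  have hw0 : ∀ y, (1 - c) / 2 ≤ w y := fun y => by
    have := mul_nonneg hc0.le (hvb y).1
    simp only [w]; linarith
  have hw1 : ∀ y, (1 - c) / 2 ≤ 1 - w y := fun y => by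
    have := mul_le_mul_of_nonneg_left (hvb y).2 hc0.le
    simp only [w]; linarith
  have hd0 : 0 < (1 - c) / 2 := by linarith
  have hlog : ∀ t, (1 - c) / 2 ≤ t → t ≤ 1 → |Real.log t| ≤ |Real.log ((1 - c) / 2)| := by
    intro t ht ht1
    have a1 := Real.log_le_log hd0 ht
    have a2 := Real.log_nonpos (hd0.le.trans ht) ht1
    rw [abs_of_nonpos a2, abs_of_nonpos (a1.trans a2)]
    linarith
  have hL1 : Measurable fun y => Real.log (w y) := Real.measurable_log.comp hwm
  have hL2 : Measurable fun y => Real.log (1 - w y) :=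
    Real.measurable_log.comp (measurable_const.sub hwm)
  have b1 : ∀ y, |Real.log (w y)| ≤ |Real.log ((1 - c) / 2)| :=
    fun y => hlog _ (hw0 y) (by linarith [hw1 y])
  have b2 : ∀ y, |Real.log (1 - w y)| ≤ |Real.log ((1 - c) / 2)| :=
    fun y => hlog _ (hw1 y) (by linarith [hw0 y])
  have hu1 : Measurable fun x => 1 - u x := measurable_const.sub hu
  have hv1 : Measurable fun x => 1 - v x := measurable_const.sub hv
  -- densities
  have D1 : HasDens π (π.withDensity (fun p => ENNReal.ofReal (u p.1))) (fun p => u p.1) :=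
    ⟨hu.comp measurable_fst, fun p => (hub _).1, rfl⟩
  have D2 : HasDens π (π.withDensity (fun p => ENNReal.ofReal (1 - u p.1))) (fun p => 1 - u p.1) :=
    ⟨hu1.comp measurable_fst, fun p => by linarith [(hub p.1).2], rfl⟩
  have E1 : HasDens ν σ v := ⟨hv, fun p => (hvb _).1, h1'⟩
  have E2 : HasDens ν σ' (fun y => 1 - v y) := ⟨hv1, fun p => by linarith [(hvb p).2], h2'⟩
  have key1 : ∀ g : X → ℝ, Measurable g → ∫ p, u p.1 * g p.2 ∂π = ∫ y, v y * g y ∂ν := by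
    intro g hg
    rw [← E1.integral_eq, ← h1, integral_map measurable_snd.aemeasurable hg.aestronglyMeasurable,
      D1.integral_eq]
  have key2 : ∀ g : X → ℝ, Measurable g →
      ∫ p, (1 - u p.1) * g p.2 ∂π = ∫ y, (1 - v y) * g y ∂ν := by
    intro g hg
    rw [← E2.integral_eq, ← h2, integral_map measurable_snd.aemeasurable hg.aestronglyMeasurable,
      D2.integral_eq]
  have hbu : Measurable fun x => Real.binEntropy (u x) :=
    Real.binEntropy_continuous.measurable.comp hu
  have hbv : Measurable fun x => Real.binEntropy (v x) :=
    Real.binEntropy_continuous.measurable.comp hv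
  have mulb : ∀ {s t C : ℝ}, 0 ≤ s ∧ s ≤ 1 → |t| ≤ C → |s * t| ≤ C := by
    intro s t C hs ht
    rw [abs_mul, abs_of_nonneg hs.1]
    nlinarith [abs_nonneg t, hs.1, hs.2]
  have hub' : ∀ x, 0 ≤ 1 - u x ∧ 1 - u x ≤ 1 := fun x =>
    ⟨by linarith [(hub x).2], by linarith [(hub x).1]⟩
  have hvb' : ∀ x, 0 ≤ 1 - v x ∧ 1 - v x ≤ 1 := fun x =>
    ⟨by linarith [(hvb x).2], by linarith [(hvb x).1]⟩
  have I1 : Integrable (fun p : X × X => u p.1 * Real.log (w p.2)) π :=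
    bdd_integrable ((hu.comp measurable_fst).mul (hL1.comp measurable_snd)) _
      fun p => mulb (hub _) (b1 _)
  have I2 : Integrable (fun p : X × X => (1 - u p.1) * Real.log (1 - w p.2)) π :=
    bdd_integrable ((hu1.comp measurable_fst).mul (hL2.comp measurable_snd)) _
      fun p => mulb (hub' _) (b2 _)
  have J1 : Integrable (fun y => v y * Real.log (w y)) ν :=
    bdd_integrable (hv.mul hL1) _ fun p => mulb (hvb _) (b1 _)
  have J2 : Integrable (fun y => (1 - v y) * Real.log (1 - w y)) ν :=
    bdd_integrable (hv1.mul hL2) _ fun p => mulb (hvb' _) (b2 _)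
  have Ib : Integrable (fun p : X × X => Real.binEntropy (u p.1)) π :=
    bdd_integrable (hbu.comp measurable_fst) (Real.log 2) fun p => binEntropy_abs_le (hub _)
  have Jb : Integrable (fun y => Real.binEntropy (v y)) ν :=
    bdd_integrable hbv (Real.log 2) fun p => binEntropy_abs_le (hvb _)
  have I1n : Integrable (fun p : X × X => -(u p.1 * Real.log (w p.2))) π := I1.neg
  have J1n : Integrable (fun y => -(v y * Real.log (w y))) ν := J1.neg
  have I12 : Integrable (fun p : X × X => -(u p.1 * Real.log (w p.2))
      - (1 - u p.1) * Real.log (1 - w p.2)) π := I1.neg.sub I2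
  have J12 : Integrable (fun y => -(v y * Real.log (w y))
      - (1 - v y) * Real.log (1 - w y)) ν := J1.neg.sub J2
  calc ∫ x, Real.binEntropy (u x) ∂μ = ∫ p, Real.binEntropy (u p.1) ∂π := by
        rw [← hπ.1, integral_map measurable_fst.aemeasurable hbu.aestronglyMeasurable]
    _ ≤ ∫ p, (-(u p.1 * Real.log (w p.2)) - (1 - u p.1) * Real.log (1 - w p.2)) ∂π := by
        refine integral_mono Ib I12 fun p => ?_
        exact gibbs (hub _).1 (hub _).2 (hd0.trans_le (hw0 _)) (by linarith [hw1 p.2])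
    _ = ∫ y, (-(v y * Real.log (w y)) - (1 - v y) * Real.log (1 - w y)) ∂ν := by
        rw [integral_sub I1n I2, integral_sub J1n J2, integral_neg, integral_neg,
          key1 _ hL1, key2 (fun y => Real.log (1 - w y)) hL2]
    _ ≤ ∫ y, (Real.binEntropy (v y) + η) ∂ν := by
        refine integral_mono J12 (Jb.add (integrable_const η)) fun y => ?_
        have g1 := gibbs' (w := w y) (hvb y).1 hc0 hlc (by simp only [w]; linarith)
        have g2 := gibbs' (w := 1 - w y) (hvb' y).1 hc0 hlc (by simp only [w]; linarith)
        simp only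
        rw [Real.binEntropy_eq_negMulLog_add_negMulLog_one_sub]
        linarith
    _ = _ := by rw [integral_add Jb (integrable_const η)]; simp

lemma smul_inv_cancel' {Y : Type*} [MeasurableSpace Y] {a : ℝ} (ha : 0 < a) (σ : Measure Y) :
    ENNReal.ofReal a • ((ENNReal.ofReal a)⁻¹ • σ) = σ := by
  have ha' : ENNReal.ofReal a ≠ 0 := by simpa using ha
  rw [smul_smul, ENNReal.mul_inv_cancel ha' ENNReal.ofReal_ne_top, one_smul]

lemma smul_inv_cancel'' {Y : Type*} [MeasurableSpace Y] {a : ℝ} (ha : 0 < a) (σ : Measure Y) :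
    ((ENNReal.ofReal a)⁻¹ • (ENNReal.ofReal a • σ)) = σ := by
  have ha' : ENNReal.ofReal a ≠ 0 := by simpa using ha
  rw [smul_smul, ENNReal.inv_mul_cancel ha' ENNReal.ofReal_ne_top, one_smul]

lemma map_fst_withDensity (π : Measure (X × X)) {f : X → ℝ≥0∞} (hf : Measurable f) :
    (π.withDensity (fun p => f p.1)).map Prod.fst = (π.map Prod.fst).withDensity f := by
  ext s hs
  rw [Measure.map_apply measurable_fst hs, withDensity_apply _ (measurable_fst hs),
    withDensity_apply _ hs, setLIntegral_map hs hf measurable_fst]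

lemma split_coupling {π : Measure (X × X)} {μ ν μ₁ μ₂ : Measure X} [IsProbabilityMeasure μ]
    [IsProbabilityMeasure ν] [IsProbabilityMeasure μ₁] [IsProbabilityMeasure μ₂]
    {a₁ a₂ : ℝ} (ha₁ : 0 < a₁) (ha₂ : 0 < a₂) {u : X → ℝ}
    (hs : SplitData μ μ₁ μ₂ a₁ a₂ u) (hπ : IsCoup π μ ν) (C : X × X → ℝ≥0∞) :
    ∃ (ν₁ ν₂ : Measure X) (π₁ π₂ : Measure (X × X)) (v : X → ℝ),
      IsProbabilityMeasure ν₁ ∧ IsProbabilityMeasure ν₂ ∧ IsCoup π₁ μ₁ ν₁ ∧ IsCoup π₂ μ₂ ν₂ ∧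
      ENNReal.ofReal a₁ * ∫⁻ p, C p ∂π₁ + ENNReal.ofReal a₂ * ∫⁻ p, C p ∂π₂ = ∫⁻ p, C p ∂π ∧
      SplitData ν ν₁ ν₂ a₁ a₂ v ∧
      ∫ x, Real.binEntropy (u x) ∂μ ≤ ∫ x, Real.binEntropy (v x) ∂ν := by
  have hm1 : Measurable fun x => ENNReal.ofReal (u x) := hs.meas.ennreal_ofReal
  have hm2 : Measurable fun x => ENNReal.ofReal (1 - u x) :=
    (measurable_const.sub hs.meas).ennreal_ofReal
  have hm1' : Measurable fun p : X × X => ENNReal.ofReal (u p.1) := hm1.comp measurable_fst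
  set κ₁ := π.withDensity (fun p => ENNReal.ofReal (u p.1)) with hκ₁
  set κ₂ := π.withDensity (fun p => ENNReal.ofReal (1 - u p.1)) with hκ₂
  have hadd : κ₁ + κ₂ = π := by
    rw [hκ₁, hκ₂, ← withDensity_add_left hm1']
    conv_rhs => rw [← withDensity_one (μ := π)]
    congr 1
    ext p
    simp only [Pi.add_apply, Pi.one_apply]
    rw [← ENNReal.ofReal_add (hs.bd _).1 (by linarith [(hs.bd p.1).2])]
    simp
  have f1 : κ₁.map Prod.fst = ENNReal.ofReal a₁ • μ₁ := by
    rw [hs.e₁, hκ₁, map_fst_withDensity π hm1, hπ.1]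
  have f2 : κ₂.map Prod.fst = ENNReal.ofReal a₂ • μ₂ := by
    rw [hs.e₂, hκ₂, map_fst_withDensity π hm2, hπ.1]
  have hadd' : κ₁.map Prod.snd + κ₂.map Prod.snd = ν := by
    rw [← Measure.map_add _ _ measurable_snd, hadd, hπ.2]
  obtain ⟨v, hv, hvb, hv1, hv2⟩ := exists_split hadd'
  have c1 : IsCoup ((ENNReal.ofReal a₁)⁻¹ • κ₁) μ₁ ((ENNReal.ofReal a₁)⁻¹ • κ₁.map Prod.snd) :=
    ⟨by rw [Measure.map_smul, f1, smul_inv_cancel'' ha₁], Measure.map_smul _ _ _⟩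
  have c2 : IsCoup ((ENNReal.ofReal a₂)⁻¹ • κ₂) μ₂ ((ENNReal.ofReal a₂)⁻¹ • κ₂.map Prod.snd) :=
    ⟨by rw [Measure.map_smul, f2, smul_inv_cancel'' ha₂], Measure.map_smul _ _ _⟩
  have pr : ∀ {π : Measure (X × X)} {μ ν : Measure X}, IsProbabilityMeasure μ → IsCoup π μ ν →
      IsProbabilityMeasure ν := by
    intro π μ ν _ h
    have := h.prob
    rw [← h.2]
    exact Measure.isProbabilityMeasure_map measurable_snd.aemeasurable
  refine ⟨_, _, _, _, v, pr inferInstance c1, pr inferInstance c2, c1, c2, ?_, ?_, ?_⟩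
  · rw [← smul_eq_mul, ← lintegral_smul_measure, ← smul_eq_mul, ← lintegral_smul_measure,
      smul_inv_cancel' ha₁, smul_inv_cancel' ha₂, ← lintegral_add_measure, hadd]
  · exact ⟨hv, hvb, by rw [smul_inv_cancel' ha₁]; exact hv1,
      by rw [smul_inv_cancel' ha₂]; exact hv2⟩
  · exact jensen hπ hs.meas hs.bd hv hvb rfl rfl hv1 hv2

end coup

section wass
variable {X : Type*} [MetricSpace X] [MeasurableSpace X]

lemma W2sq_le {π : Measure (X × X)} {μ ν : Measure X} (h : IsCoup π μ ν) :
    W2sq μ ν ≤ ∫⁻ p, edist p.1 p.2 ^ 2 ∂π :=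
  iInf₂_le π h

lemma exists_coup {μ ν : Measure X} {c : ℝ≥0∞} (h : W2sq μ ν < c) :
    ∃ π, IsCoup π μ ν ∧ ∫⁻ p, edist p.1 p.2 ^ 2 ∂π < c := by
  unfold W2sq at h
  simp only [iInf_lt_iff] at h
  obtain ⟨π, hπ, h⟩ := h
  exact ⟨π, hπ, h⟩

lemma W2_eq_zero {μ ν : Measure X} : W2 μ ν = 0 ↔ W2sq μ ν = 0 := by
  unfold W2
  rw [ENNReal.rpow_eq_zero_iff]
  norm_num

lemma W2_sq (μ ν : Measure X) : W2 μ ν ^ 2 = W2sq μ ν := by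
  unfold W2
  rw [← ENNReal.rpow_natCast, ← ENNReal.rpow_mul]
  norm_num

lemma W2_lt {μ ν : Measure X} {ε : ℝ≥0∞} : W2 μ ν < ε ↔ W2sq μ ν < ε ^ 2 := by
  rw [← W2_sq]
  exact (ENNReal.pow_lt_pow_left_iff (by norm_num)).symm

lemma W2_toReal (μ ν : Measure X) : (W2 μ ν).toReal = Real.sqrt (W2sq μ ν).toReal := by
  rw [← W2_sq, ENNReal.toReal_pow, Real.sqrt_sq ENNReal.toReal_nonneg]

lemma sq_integral_le {Y : Type*} [MeasurableSpace Y] {π : Measure Y} [IsProbabilityMeasure π]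
    {g : Y → ℝ} (hg : Measurable g) {C : ℝ} (hC : ∀ x, |g x| ≤ C) :
    (∫ x, g x ∂π) ^ 2 ≤ ∫ x, g x ^ 2 ∂π := by
  set t := ∫ x, g x ∂π with ht
  have i1 : Integrable g π := bdd_integrable hg C hC
  have i2 : Integrable (fun x => g x ^ 2) π :=
    bdd_integrable (hg.pow_const 2) (C ^ 2) fun x => by
      rw [abs_of_nonneg (sq_nonneg _)]; exact sq_le_sq' (abs_le.1 (hC x)).1 (abs_le.1 (hC x)).2
  have h : 0 ≤ ∫ x, (g x - t) ^ 2 ∂π := integral_nonneg fun x => sq_nonneg _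
  have e : ∀ x, (g x - t) ^ 2 = g x ^ 2 - 2 * t * g x + t ^ 2 := fun x => by ring
  simp only [e] at h
  have i3 : Integrable (fun x => g x ^ 2 - 2 * t * g x) π := i2.sub (i1.const_mul (2 * t))
  rw [integral_add i3 (integrable_const _),
    integral_sub i2 (i1.const_mul (2 * t)), integral_const_mul, ← ht] at h
  simp at h
  nlinarith

lemma lip_test_coup {π : Measure (X × X)} {μ ν : Measure X} [IsProbabilityMeasure μ]
    (h : IsCoup π μ ν) {f : X → ℝ} (hf : Measurable f) (hb : ∀ x, |f x| ≤ 1)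
    {K : ℝ≥0} (hK : LipschitzWith K f) {c : ℝ} (hc0 : 0 ≤ c)
    (hc : ∫⁻ p, edist p.1 p.2 ^ 2 ∂π ≤ ENNReal.ofReal c) :
    (∫ x, f x ∂μ - ∫ x, f x ∂ν) ^ 2 ≤ K ^ 2 * c := by
  have := h.prob
  have m1 : Measurable fun p : X × X => f p.1 := hf.comp measurable_fst
  have m2 : Measurable fun p : X × X => f p.2 := hf.comp measurable_snd
  have mg : Measurable fun p : X × X => f p.1 - f p.2 := m1.sub m2
  have e : ∫ x, f x ∂μ - ∫ x, f x ∂ν = ∫ p, (f p.1 - f p.2) ∂π := by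
    rw [integral_sub (bdd_integrable m1 1 fun p => hb _) (bdd_integrable m2 1 fun p => hb _),
      ← h.1, ← h.2, integral_map measurable_fst.aemeasurable hf.aestronglyMeasurable,
      integral_map measurable_snd.aemeasurable hf.aestronglyMeasurable]
  rw [e]
  refine (sq_integral_le mg (C := 2) fun p => ?_).trans ?_
  · have := abs_sub (f p.1) (f p.2)
    linarith [hb p.1, hb p.2]
  rw [integral_eq_lintegral_of_nonneg_ae (Eventually.of_forall fun x => sq_nonneg _)
    (mg.pow_const 2).aestronglyMeasurable]
  refine ENNReal.toReal_le_of_le_ofReal (by positivity) ?_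
  calc ∫⁻ p, ENNReal.ofReal ((f p.1 - f p.2) ^ 2) ∂π
      ≤ ∫⁻ p, (K : ℝ≥0∞) ^ 2 * edist p.1 p.2 ^ 2 ∂π := by
        refine lintegral_mono fun p => ?_
        have h1 := hK p.1 p.2
        rw [edist_dist (f p.1), Real.dist_eq] at h1
        rw [← sq_abs, ENNReal.ofReal_pow (abs_nonneg _), ← mul_pow]
        exact pow_le_pow_left' h1 2
    _ = (K : ℝ≥0∞) ^ 2 * ∫⁻ p, edist p.1 p.2 ^ 2 ∂π :=
        lintegral_const_mul' _ _ (by simp)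
    _ ≤ (K : ℝ≥0∞) ^ 2 * ENNReal.ofReal c := by gcongr
    _ = ENNReal.ofReal (K ^ 2 * c) := by
        rw [ENNReal.ofReal_mul (by positivity), ENNReal.ofReal_pow (by positivity),
          ENNReal.ofReal_coe_nnreal]

lemma lip_test {μ ν : Measure X} [IsProbabilityMeasure μ]
    {f : X → ℝ} (hf : Measurable f) (hb : ∀ x, |f x| ≤ 1)
    {K : ℝ≥0} (hK : LipschitzWith K f) {c : ℝ} (hc0 : 0 ≤ c)
    (hc : W2sq μ ν < ENNReal.ofReal c) :
    (∫ x, f x ∂μ - ∫ x, f x ∂ν) ^ 2 ≤ K ^ 2 * c := by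
  obtain ⟨π, hπ, h⟩ := exists_coup hc
  exact lip_test_coup hπ hf hb hK hc0 h.le

lemma ext_lip [BorelSpace X] {μ ν : Measure X} [IsProbabilityMeasure μ] [IsProbabilityMeasure ν]
    (h : ∀ (f : X → ℝ) (K : ℝ≥0), Measurable f → (∀ x, |f x| ≤ 1) → LipschitzWith K f →
      ∫ x, f x ∂μ = ∫ x, f x ∂ν) : μ = ν := by
  refine ext_of_generate_finite {s : Set X | IsClosed s} (by
      rw [BorelSpace.measurable_eq (α := X), borel_eq_generateFrom_isClosed]) isPiSystem_isClosed (fun s hs => ?_) (by simp)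
  let fs : ℕ → X → ℝ := fun n x => thickenedIndicator (δ := (1 : ℝ) / (n + 1)) (by positivity) s x
  have k : ∀ (μ : Measure X) [IsProbabilityMeasure μ],
      Tendsto (fun n => ∫ x, fs n x ∂μ) atTop (𝓝 (μ.real s)) := fun μ _ =>
    tendsto_integral_thickenedIndicator_of_isClosed μ hs (δs := fun n => (1 : ℝ) / (n + 1))
      (fun _ => by positivity) tendsto_one_div_add_atTop_nhds_zero_nat
  have hl : ∀ n : ℕ, ∃ K : ℝ≥0, LipschitzWith K (fs n) := fun n =>
    ⟨_, lipschitzWith_thickenedIndicator (δ := (1 : ℝ) / (n + 1)) (by positivity) s⟩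
  have e : ∀ n, ∫ x, fs n x ∂μ = ∫ x, fs n x ∂ν := fun n => by
    obtain ⟨K, hK⟩ := hl n
    refine h (fs n) K hK.continuous.measurable (fun x => ?_) hK
    rw [abs_of_nonneg (by simp [fs])]
    exact thickenedIndicator_le_one _ _ _
  have k1 := k μ
  simp only [e] at k1
  have := tendsto_nhds_unique k1 (k ν)
  rwa [measureReal_eq_measureReal_iff] at this

lemma eq_of_W2sq [BorelSpace X] {μ ν : Measure X} [IsProbabilityMeasure μ]
    [IsProbabilityMeasure ν] (h : W2sq μ ν = 0) : μ = ν := by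
  refine ext_lip fun f K hf hb hK => ?_
  have h1 : ∀ c : ℝ, 0 < c → (∫ x, f x ∂μ - ∫ x, f x ∂ν) ^ 2 ≤ K ^ 2 * c := fun c hc =>
    lip_test hf hb hK hc.le (by rw [h]; simpa using hc)
  by_contra hne
  have h2 : 0 < (∫ x, f x ∂μ - ∫ x, f x ∂ν) ^ 2 := by
    have := sub_ne_zero.2 hne
    positivity
  set A := (∫ x, f x ∂μ - ∫ x, f x ∂ν) ^ 2
  have h3 := h1 (A / (2 * (K ^ 2 + 1))) (by positivity)
  have h4 : (K : ℝ) ^ 2 * (A / (2 * (K ^ 2 + 1))) ≤ A / 2 := by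
    rw [mul_div_assoc', div_le_div_iff₀ (by positivity) (by positivity)]
    nlinarith [h2]
  linarith

lemma W2sq_mid {μ ν ν' : Measure X} {ε : ℝ≥0∞} (h : W2sq μ ν < ε) (h' : W2sq μ ν' < ε) :
    W2sq μ (ENNReal.ofReal (1/2) • ν + ENNReal.ofReal (1/2) • ν') ≤ ε := by
  obtain ⟨π, hπ, h⟩ := exists_coup h
  obtain ⟨π', hπ', h'⟩ := exists_coup h'
  have hh : ENNReal.ofReal (1/2) + ENNReal.ofReal (1/2) = 1 := by
    rw [← ENNReal.ofReal_add (by norm_num) (by norm_num)]; norm_num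
  have hc : IsCoup (ENNReal.ofReal (1/2) • π + ENNReal.ofReal (1/2) • π') μ
      (ENNReal.ofReal (1/2) • ν + ENNReal.ofReal (1/2) • ν') := by
    constructor
    · rw [Measure.map_add _ _ measurable_fst, Measure.map_smul, Measure.map_smul, hπ.1, hπ'.1,
        ← add_smul, hh, one_smul]
    · rw [Measure.map_add _ _ measurable_snd, Measure.map_smul, Measure.map_smul, hπ.2, hπ'.2]
  refine (W2sq_le hc).trans ?_
  rw [lintegral_add_measure, lintegral_smul_measure, lintegral_smul_measure]
  calc _ ≤ ENNReal.ofReal (1/2) • ε + ENNReal.ofReal (1/2) • ε := by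
        simp only [smul_eq_mul]; gcongr
    _ = ε := by rw [← add_smul, hh, one_smul]

/-- finite slope gives a quantitative lower bound -/
lemma slope_bound [BorelSpace X] {m μ : Measure X} [IsProbabilityMeasure μ]
    (hs : entDescSlope m μ ≠ ⊤) {δ : ℝ} (hδ : 0 < δ) :
    ∃ ε : ℝ, 0 < ε ∧ ∀ (ν : Measure X) (c : ℝ), MemEntDom m ν → c < ε →
      W2sq μ ν ≤ ENNReal.ofReal c →
      relEnt m μ - relEnt m ν ≤ ((entDescSlope m μ).toReal + δ) * Real.sqrt c := by
  have h1 : entDescSlope m μ < entDescSlope m μ + ENNReal.ofReal δ :=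
    ENNReal.lt_add_right hs (by simpa using hδ)
  conv_lhs at h1 => unfold entDescSlope
  simp only [iInf_lt_iff] at h1
  obtain ⟨ε, hε, h1⟩ := h1
  obtain ⟨ε', hε', hlt⟩ : ∃ r : ℝ≥0, (0:ℝ≥0∞) < r ∧ (r : ℝ≥0∞) < ε := by
    obtain ⟨r, h1, h2⟩ := ENNReal.lt_iff_exists_nnreal_btwn.1 hε
    exact ⟨r, h1, h2⟩
  have hε0 : 0 < ε' := by exact_mod_cast hε'
  refine ⟨(ε' : ℝ) ^ 2, by positivity, fun ν c hν hc hW => ?_⟩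
  have : IsProbabilityMeasure ν := hν.1
  have hsl : 0 ≤ (entDescSlope m μ).toReal + δ := by positivity
  by_cases h0 : W2 μ ν = 0
  · rw [eq_of_W2sq (W2_eq_zero.1 h0), sub_self]; positivity
  have hlt2 : W2 μ ν < ε := by
    rw [W2_lt]
    calc W2sq μ ν ≤ ENNReal.ofReal c := hW
      _ ≤ ENNReal.ofReal ((ε' : ℝ) ^ 2) := ENNReal.ofReal_le_ofReal hc.le
      _ = (ε' : ℝ≥0∞) ^ 2 := by
        rw [ENNReal.ofReal_pow (by positivity), ENNReal.ofReal_coe_nnreal]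
      _ < ε ^ 2 := (ENNReal.pow_lt_pow_left_iff (by norm_num)).2 hlt
  have h2 := (le_iSup₂ (f := fun (ν : Measure X) (_ : MemEntDom m ν ∧ 0 < W2 μ ν ∧ W2 μ ν < ε) =>
      ENNReal.ofReal (relEnt m μ - relEnt m ν) / W2 μ ν) ν
      ⟨hν, pos_iff_ne_zero.2 h0, hlt2⟩).trans h1.le
  have hWt : W2 μ ν ≠ ⊤ := hlt2.ne_top
  rw [ENNReal.div_le_iff h0 hWt] at h2
  have h3 : (W2 μ ν).toReal ≤ Real.sqrt c := by
    rw [W2_toReal]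
    by_cases hc0 : 0 ≤ c
    · exact Real.sqrt_le_sqrt (ENNReal.toReal_le_of_le_ofReal hc0 hW)
    · rw [ENNReal.ofReal_of_nonpos (not_le.1 hc0).le] at hW
      exact absurd (W2_eq_zero.2 (le_antisymm hW bot_le)) h0
  have h4 : (entDescSlope m μ + ENNReal.ofReal δ) * W2 μ ν =
      ENNReal.ofReal (((entDescSlope m μ).toReal + δ) * (W2 μ ν).toReal) := by
    rw [ENNReal.ofReal_mul hsl, ENNReal.ofReal_add ENNReal.toReal_nonneg hδ.le,
      ENNReal.ofReal_toReal hs, ENNReal.ofReal_toReal hWt]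
  rw [h4, ENNReal.ofReal_le_ofReal_iff (by positivity)] at h2
  exact h2.trans (mul_le_mul_of_nonneg_left h3 hsl)

lemma slope_le {m μ : Measure X} {K ε : ℝ} (hK : 0 ≤ K) (hε : 0 < ε)
    (h : ∀ (ν : Measure X) (c : ℝ), MemEntDom m ν → 0 < c → c < ε → W2sq μ ν < ENNReal.ofReal c →
      relEnt m μ - relEnt m ν ≤ K * Real.sqrt c) :
    entDescSlope m μ ≤ ENNReal.ofReal K := by
  unfold entDescSlope
  refine (iInf₂_le (ENNReal.ofReal (Real.sqrt ε)) (by simpa using hε)).trans ?_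
  refine iSup₂_le fun ν hν => ?_
  obtain ⟨hν, hW0, hW⟩ := hν
  have hWt : W2 μ ν ≠ ⊤ := hW.ne_top
  rw [ENNReal.div_le_iff hW0.ne' hWt, ← ENNReal.ofReal_toReal hWt, ← ENNReal.ofReal_mul hK]
  refine ENNReal.ofReal_le_ofReal ?_
  rw [W2_lt, ← ENNReal.ofReal_pow (Real.sqrt_nonneg _), Real.sq_sqrt hε.le] at hW
  set w := (W2sq μ ν).toReal with hw
  have hwt : W2sq μ ν = ENNReal.ofReal w := (ENNReal.ofReal_toReal hW.ne_top).symm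
  rw [W2_toReal, ← hw]
  have hwε : w < ε := by
    rwa [hwt, ENNReal.ofReal_lt_ofReal_iff hε] at hW
  have hw0 : 0 ≤ w := ENNReal.toReal_nonneg
  have ht : Tendsto (fun c => K * Real.sqrt c) (𝓝[>] w) (𝓝 (K * Real.sqrt w)) :=
    (Real.continuous_sqrt.continuousAt.tendsto.mono_left nhdsWithin_le_nhds).const_mul K
  refine ge_of_tendsto ht ?_
  filter_upwards [Ioo_mem_nhdsGT hwε] with c hc
  refine h ν c hν (hw0.trans_lt hc.1) hc.2 ?_
  rw [hwt, ENNReal.ofReal_lt_ofReal_iff (hw0.trans_lt hc.1)]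
  exact hc.1

end wass

lemma mul_log_ge {s : ℝ} (h0 : 0 ≤ s) (h2 : s ≤ 2) :
    (s - 1) + (s - 1) ^ 2 / 6 ≤ s * Real.log s := by
  rcases h0.eq_or_lt with h | h
  · subst h; norm_num
  obtain ⟨p, hp, rfl⟩ : ∃ p : ℝ, 0 < p ∧ p ^ 2 = s :=
    ⟨Real.sqrt s, Real.sqrt_pos.2 h, Real.sq_sqrt h0⟩
  have h3 := Real.one_sub_inv_le_log_of_pos hp
  have h4 : p ^ 2 - p ≤ p ^ 2 * Real.log p := by
    have := mul_le_mul_of_nonneg_left h3 (sq_nonneg p)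
    have e : p ^ 2 * (1 - p⁻¹) = p ^ 2 - p := by field_simp
    linarith
  rw [Real.log_pow]
  push_cast
  have h5 : p ≤ 1.42 := by nlinarith
  have h6 : (p + 1) ^ 2 ≤ 6 := by nlinarith
  have h7 : (p ^ 2 - 1) ^ 2 = (p - 1) ^ 2 * (p + 1) ^ 2 := by ring
  have h8 := mul_le_mul_of_nonneg_left h6 (sq_nonneg (p - 1))
  nlinarith

lemma binEntropy_gap {u : ℝ} (h : 0 ≤ u ∧ u ≤ 1) :
    (u - 1 / 2) ^ 2 ≤ 2 * (Real.log 2 - Real.binEntropy u) := by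
  have h1 := mul_log_ge (s := 2 * u) (by linarith [h.1]) (by linarith [h.2])
  have h2 := mul_log_ge (s := 2 * (1 - u)) (by linarith [h.2]) (by linarith [h.1])
  have e : ∀ t : ℝ, 2 * t * Real.log (2 * t) = 2 * t * Real.log 2 - 2 * Real.negMulLog t := by
    intro t
    by_cases ht : t = 0
    · subst ht; simp
    rw [Real.log_mul (by norm_num) ht, Real.negMulLog]; ring
  rw [e] at h1 h2
  rw [Real.binEntropy_eq_negMulLog_add_negMulLog_one_sub]
  nlinarith [sq_nonneg (u - 1/2)]

lemma HasDens.ae_eq {X : Type*} [MeasurableSpace X] {m μ : Measure X} [IsFiniteMeasure μ]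
    {ρ ρ' : X → ℝ} (h : HasDens m μ ρ) (h' : HasDens m μ ρ') : ρ =ᵐ[m] ρ' :=
  h.rnDeriv.symm.trans h'.rnDeriv

lemma half_sum {X : Type*} [MeasurableSpace X] (ν ν' : Measure X) [IsProbabilityMeasure ν]
    [IsProbabilityMeasure ν'] {a b : ℝ} (ha : 0 < a) (hb : 0 < b) (hab : a + b = 1) :
    IsProbabilityMeasure (ENNReal.ofReal a • ν + ENNReal.ofReal b • ν') := by
  constructor
  simp only [Measure.add_apply, Measure.smul_apply, measure_univ, smul_eq_mul, mul_one]
  rw [← ENNReal.ofReal_add ha.le hb.le, hab, ENNReal.ofReal_one]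

lemma exists_splitData {X : Type*} [MeasurableSpace X] (ν ν' : Measure X) [IsProbabilityMeasure ν]
    [IsProbabilityMeasure ν'] {a b : ℝ} (ha : 0 < a) (hb : 0 < b) (hab : a + b = 1) :
    ∃ u, SplitData (ENNReal.ofReal a • ν + ENNReal.ofReal b • ν') ν ν' a b u := by
  have := half_sum ν ν' ha hb hab
  obtain ⟨u, h1, h2, h3, h4⟩ := exists_split
    (rfl : ENNReal.ofReal a • ν + ENNReal.ofReal b • ν' = _)
  exact ⟨u, h1, h2, h3, h4⟩

lemma dec_smul {X : Type*} [MeasurableSpace X] {m ν : Measure X} [IsFiniteMeasure ν] (h : Dec m ν)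
    (a : ℝ) : Dec m (ENNReal.ofReal a • ν) := by
  have : IsFiniteMeasure (ENNReal.ofReal a • ν) := Measure.smul_finite ν ENNReal.ofReal_ne_top
  exact h.of_ac Measure.smul_absolutelyContinuous

lemma dec_comb {X : Type*} [MeasurableSpace X] {m ν ν' : Measure X} [IsFiniteMeasure ν]
    [IsFiniteMeasure ν'] (h : Dec m ν) (h' : Dec m ν') (a b : ℝ) :
    Dec m (ENNReal.ofReal a • ν + ENNReal.ofReal b • ν') := by
  have : IsFiniteMeasure (ENNReal.ofReal a • ν) := Measure.smul_finite ν ENNReal.ofReal_ne_top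
  have : IsFiniteMeasure (ENNReal.ofReal b • ν') := Measure.smul_finite ν' ENNReal.ofReal_ne_top
  exact (dec_smul h a).add (dec_smul h' b)

lemma mid_l1 {X : Type*} [MeasurableSpace X] {m ν ν' : Measure X} [IsProbabilityMeasure ν]
    [IsProbabilityMeasure ν'] {ρ ρ' : X → ℝ} (h : HasDens m ν ρ) (h' : HasDens m ν' ρ')
    (hd : MemEntDom m ν) (hd' : MemEntDom m ν') {J e : ℝ} (h1 : relEnt m ν ≤ J + e)
    (h2 : relEnt m ν' ≤ J + e)
    (h3 : MemEntDom m (ENNReal.ofReal (1/2) • ν + ENNReal.ofReal (1/2) • ν') →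
      J - e ≤ relEnt m (ENNReal.ofReal (1/2) • ν + ENNReal.ofReal (1/2) • ν')) :
    (∫ x, |ρ x - ρ' x| ∂m) ^ 2 ≤ 64 * e := by
  have hh : (0:ℝ) < 1 / 2 := by norm_num
  have hP := half_sum ν ν' hh hh (by norm_num)
  obtain ⟨u, hu⟩ := exists_splitData ν ν' hh hh (by norm_num)
  have hdec := dec_comb (m := m) ⟨ρ, h⟩ ⟨ρ', h'⟩ (1/2) (1/2)
  set η := ENNReal.ofReal (1/2) • ν + ENNReal.ofReal (1/2) • ν' with hη
  obtain ⟨E1, E2⟩ := hu.entropy hh hh (by norm_num) hdec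
  have hηd := E1.2 ⟨hd, hd'⟩
  have E3 := E2 hηd
  have h3 := h3 hηd
  have hbl : Real.binEntropy (1/2) = Real.log 2 := by
    rw [one_div]; exact Real.binEntropy_two_inv
  rw [hbl] at E3
  obtain ⟨r, hr⟩ := hdec
  have p1 := h.ae_eq (hr.piece hh hu.meas (fun x => (hu.bd x).1) hu.e₁)
  have p2 := h'.ae_eq (hr.piece (u := fun x => 1 - u x) hh (measurable_const.sub hu.meas)
    (fun x => by linarith [(hu.bd x).2]) hu.e₂)
  have e1 : ∫ x, |ρ x - ρ' x| ∂m = 4 * ∫ x, |u x - 1/2| ∂η := by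
    rw [hr.integral_eq, ← integral_const_mul]
    refine integral_congr_ae ?_
    filter_upwards [p1, p2] with x q1 q2
    rw [q1, q2]
    have : u x * r x / (1/2) - (1 - u x) * r x / (1/2) = r x * 4 * (u x - 1/2) := by ring
    rw [this, abs_mul, abs_of_nonneg (mul_nonneg (hr.2.1 x) (by norm_num))]
    ring
  have mu : Measurable fun x => |u x - 1/2| := (hu.meas.sub_const _).abs
  have bu : ∀ x, |u x - 1/2| ≤ 1 := fun x => by
    rw [abs_le]; constructor <;> linarith [(hu.bd x).1, (hu.bd x).2]
  have s1 := sq_integral_le (π := η) mu (C := 1) (fun x => by rw [abs_abs]; exact bu x)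
  have mb : Measurable fun x => Real.binEntropy (u x) :=
    Real.binEntropy_continuous.measurable.comp hu.meas
  have ib : Integrable (fun x => Real.binEntropy (u x)) η :=
    bdd_integrable mb (Real.log 2) fun x => binEntropy_abs_le (hu.bd x)
  have i2 : Integrable (fun x => 2 * (Real.log 2 - Real.binEntropy (u x))) η :=
    ((integrable_const _).sub ib).const_mul 2
  have i1 : Integrable (fun x => |u x - 1/2| ^ 2) η :=
    bdd_integrable (mu.pow_const 2) 1 fun x => by
      rw [abs_of_nonneg (by positivity)]
      exact pow_le_one₀ (abs_nonneg _) (bu x)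
  have s2 : ∫ x, |u x - 1/2| ^ 2 ∂η ≤ ∫ x, 2 * (Real.log 2 - Real.binEntropy (u x)) ∂η :=
    integral_mono i1 i2 fun x => by
      simp only [sq_abs]; exact binEntropy_gap (hu.bd x)
  rw [integral_const_mul, integral_sub (integrable_const _) ib] at s2
  simp at s2
  rw [e1, mul_pow]
  norm_num at s1 s2 E3 ⊢
  linarith

section L1lim
variable {X : Type*} [MeasurableSpace X]

/-- An `L¹`-fast Cauchy sequence of probability densities has a limit density. -/
lemma l1_limit {m : Measure X} {ν : ℕ → Measure X} (hν : ∀ n, IsProbabilityMeasure (ν n))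
    {ρ : ℕ → X → ℝ} (h : ∀ n, HasDens m (ν n) (ρ n)) {C : ℝ}
    (hc : ∀ n, ∫ x, |ρ n x - ρ (n+1) x| ∂m ≤ C * (1/2) ^ n) :
    ∃ (η : Measure X), IsProbabilityMeasure η ∧ Dec m η ∧
      ∀ f : X → ℝ, Measurable f → (∀ x, |f x| ≤ 1) →
        Tendsto (fun n => ∫ x, f x ∂(ν n)) atTop (𝓝 (∫ x, f x ∂η)) := by
  have hi : ∀ n, Integrable (ρ n) m := fun n => (h n).integrable
  let F : ℕ → (X →₁[m] ℝ) := fun n => (hi n).toL1 (ρ n)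
  have hd : ∀ n, dist (F n) (F (n+1)) = ∫ x, |ρ n x - ρ (n+1) x| ∂m := fun n => by
    rw [dist_eq_norm, ← Integrable.toL1_sub, L1.norm_of_fun_eq_integral_norm]
    rfl
  have hcau : CauchySeq F := cauchySeq_of_le_geometric (1/2) C (by norm_num) fun n => by
    rw [hd]; exact hc n
  obtain ⟨G, hG⟩ := cauchySeq_tendsto_of_complete hcau
  have hGi : Integrable G m := L1.integrable_coeFn G
  let r : X → ℝ := fun x => max ((hGi.1.mk G) x) 0
  have hrm : Measurable r := (hGi.1.stronglyMeasurable_mk.measurable).max measurable_const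
  have hr0 : ∀ x, 0 ≤ r x := fun x => le_max_right _ _
  have hri : Integrable r m := by
    have : Integrable (hGi.1.mk G) m := hGi.congr hGi.1.ae_eq_mk
    exact this.pos_part
  have hlim : Tendsto (fun n => ∫ x, |ρ n x - r x| ∂m) atTop (𝓝 0) := by
    have h1 := tendsto_iff_dist_tendsto_zero.1 hG
    refine squeeze_zero (fun n => integral_nonneg fun x => abs_nonneg _) (fun n => ?_) h1
    rw [dist_eq_norm, L1.norm_eq_integral_norm]
    refine integral_mono_ae ((hi n).sub hri).abs (L1.integrable_coeFn _).norm ?_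
    filter_upwards [Lp.coeFn_sub (F n) G, (hi n).coeFn_toL1, hGi.1.ae_eq_mk] with x q1 q2 q3
    have q2' : (F n) x = ρ n x := q2
    rw [q1, Pi.sub_apply, q2', q3, Real.norm_eq_abs]
    have := abs_max_sub_max_le_abs (ρ n x) ((hGi.1.mk G) x) 0
    rwa [max_eq_left ((h n).2.1 x)] at this
  let η := m.withDensity fun x => ENNReal.ofReal (r x)
  have hη : HasDens m η r := ⟨hrm, hr0, rfl⟩
  have key : ∀ f : X → ℝ, Measurable f → (∀ x, |f x| ≤ 1) →
      Tendsto (fun n => ∫ x, f x ∂(ν n)) atTop (𝓝 (∫ x, f x ∂η)) := by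
    intro f hf hb
    rw [tendsto_iff_dist_tendsto_zero]
    refine squeeze_zero (fun n => dist_nonneg) (fun n => ?_) hlim
    rw [hη.integral_eq, (h n).integral_eq, Real.dist_eq]
    have j : ∀ {g : X → ℝ}, Integrable g m → Integrable (fun x => g x * f x) m := fun hg =>
      hg.mul_bdd (c := 1) hf.aestronglyMeasurable (Eventually.of_forall hb)
    rw [← integral_sub (j (hi n)) (j hri)]
    refine abs_integral_le_integral_abs.trans ?_
    refine integral_mono ((j (hi n)).sub (j hri)).abs ((hi n).sub hri).abs fun x => ?_
    simp only
    rw [← sub_mul, abs_mul]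
    exact mul_le_of_le_one_right (abs_nonneg _) (hb x)
  have hP : IsProbabilityMeasure η := by
    constructor
    have h1 := key (fun _ => 1) measurable_const (by simp)
    have h2 : ∀ n, ∫ x, (1:ℝ) ∂(ν n) = 1 := fun n => by
      have := hν n
      simp
    simp only [h2] at h1
    have h3 := tendsto_nhds_unique h1 tendsto_const_nhds
    rw [hη.integral_eq] at h3
    simp only [mul_one] at h3
    show (m.withDensity fun x => ENNReal.ofReal (r x)) Set.univ = 1
    rw [withDensity_apply _ MeasurableSet.univ, setLIntegral_univ,
      ← ofReal_integral_eq_lintegral_ofReal hri (Eventually.of_forall hr0), h3, ENNReal.ofReal_one]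
  exact ⟨η, hP, ⟨r, hη⟩, key⟩

end L1lim

section lemL
variable {X : Type*} [MetricSpace X] [MeasurableSpace X] [BorelSpace X]

lemma lower_bound {m μ : Measure X} [IsProbabilityMeasure μ] (hs : entDescSlope m μ ≠ ⊤) :
    ∃ ε B : ℝ, 0 < ε ∧ ∀ ν, MemEntDom m ν → W2sq μ ν < ENNReal.ofReal ε → B ≤ relEnt m ν := by
  obtain ⟨ε, hε, h⟩ := slope_bound hs one_pos
  refine ⟨ε / 2, relEnt m μ - ((entDescSlope m μ).toReal + 1) * Real.sqrt (ε/2), by positivity,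
    fun ν hν hW => ?_⟩
  have := h ν (ε / 2) hν (by linarith) hW.le
  linarith

lemma lemL {m μ : Measure X} [IsProbabilityMeasure μ] (hs : entDescSlope m μ ≠ ⊤)
    (hnd : ¬ Dec m μ) (C : ℝ) :
    ∃ ε : ℝ, 0 < ε ∧ ∀ ν, MemEntDom m ν → Dec m ν → W2sq μ ν < ENNReal.ofReal ε →
      C ≤ relEnt m ν := by
  by_contra! hcon
  obtain ⟨ε₀, B, hε₀, hB⟩ := lower_bound hs
  let S : ℝ → Set ℝ := fun ε => {t | ∃ ν, MemEntDom m ν ∧ Dec m ν ∧ W2sq μ ν < ENNReal.ofReal ε ∧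
    relEnt m ν = t}
  have Sbdd : ∀ ε ≤ ε₀, BddBelow (S ε) := by
    intro ε hε
    refine ⟨B, ?_⟩
    rintro t ⟨ν, h1, h2, h3, rfl⟩
    exact hB ν h1 (h3.trans_le (ENNReal.ofReal_le_ofReal hε))
  have Sne : ∀ ε > 0, ∃ t ∈ S ε, t < C := by
    intro ε hε
    obtain ⟨ν, h1, h2, h3, h4⟩ := hcon ε hε
    exact ⟨_, ⟨ν, h1, h2, h3, rfl⟩, h4⟩
  have SleC : ∀ ε, 0 < ε → ε ≤ ε₀ → sInf (S ε) ≤ C := by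
    intro ε hε hε'
    obtain ⟨t, ht, htC⟩ := Sne ε hε
    exact (csInf_le (Sbdd ε hε') ht).trans htC.le
  let T : Set ℝ := (fun ε => sInf (S ε)) '' Set.Ioc 0 ε₀
  have Tbdd : BddAbove T := ⟨C, by rintro _ ⟨ε, hε, rfl⟩; exact SleC ε hε.1 hε.2⟩
  have Tne : T.Nonempty := ⟨_, ⟨ε₀, ⟨hε₀, le_rfl⟩, rfl⟩⟩
  set J := sSup T with hJ
  have A1 : ∀ e > 0, ∃ ε > 0, ∀ ν, MemEntDom m ν → Dec m ν → W2sq μ ν < ENNReal.ofReal ε →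
      J - e ≤ relEnt m ν := by
    intro e he
    obtain ⟨_, ⟨ε, hε, rfl⟩, h1⟩ := exists_lt_of_lt_csSup Tne (show J - e < sSup T by linarith)
    refine ⟨ε, hε.1, fun ν a b c => h1.le.trans (csInf_le (Sbdd ε hε.2) ⟨ν, a, b, c, rfl⟩)⟩
  have A2 : ∀ e > 0, ∀ ε > 0, ∃ ν, MemEntDom m ν ∧ Dec m ν ∧ W2sq μ ν < ENNReal.ofReal ε ∧
      relEnt m ν ≤ J + e := by
    intro e he ε hε
    have hm : 0 < min ε ε₀ := lt_min hε hε₀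
    have h1 : sInf (S (min ε ε₀)) ≤ J :=
      le_csSup Tbdd ⟨_, ⟨hm, min_le_right _ _⟩, rfl⟩
    obtain ⟨t0, ht0, -⟩ := Sne _ hm
    obtain ⟨t, ⟨ν, a, b, c, rfl⟩, h2⟩ := exists_lt_of_csInf_lt ⟨t0, ht0⟩
      (show sInf (S (min ε ε₀)) < J + e by linarith)
    exact ⟨ν, a, b, c.trans_le (ENNReal.ofReal_le_ofReal (min_le_left _ _)), h2.le⟩
  choose E hE0 hE using fun n : ℕ => A1 ((1/4) ^ n) (by positivity)
  choose ν hν1 hν2 hν3 hν4 using fun n : ℕ => A2 ((1/4) ^ n) (by positivity)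
    (min (min (E n / 2) (E (n-1) / 2)) (1 / (n+1)))
    (lt_min (lt_min (half_pos (hE0 _)) (half_pos (hE0 _))) (by positivity))
  have hP : ∀ n, IsProbabilityMeasure (ν n) := fun n => (hν1 n).1
  choose ρ hρ using hν2
  have l1 : ∀ n, ∫ x, |ρ n x - ρ (n+1) x| ∂m ≤ 8 * (1/2) ^ n := by
    intro n
    have w1 : W2sq μ (ν n) < ENNReal.ofReal (E n / 2) :=
      (hν3 n).trans_le (ENNReal.ofReal_le_ofReal ((min_le_left _ _).trans (min_le_left _ _)))
    have w2 : W2sq μ (ν (n+1)) < ENNReal.ofReal (E n / 2) :=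
      (hν3 (n+1)).trans_le (ENNReal.ofReal_le_ofReal ((min_le_left _ _).trans (min_le_right _ _)))
    have w3 := W2sq_mid w1 w2
    have hdec := dec_comb ⟨_, hρ n⟩ ⟨_, hρ (n+1)⟩ (1/2) (1/2)
    have h4 : ((1:ℝ)/4) ^ (n+1) ≤ (1/4) ^ n := by
      rw [pow_succ]; nlinarith [show (0:ℝ) ≤ (1/4)^n by positivity]
    have := mid_l1 (hρ n) (hρ (n+1)) (hν1 n) (hν1 (n+1)) (hν4 n) ((hν4 (n+1)).trans (by linarith))
      (fun hd => hE n _ hd hdec (w3.trans_lt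
        ((ENNReal.ofReal_lt_ofReal_iff (hE0 n)).2 (half_lt_self (hE0 n)))))
    refine abs_le_of_sq_le_sq' ?_ (by positivity) |>.2
    calc _ ≤ _ := this
      _ = (8 * (1/2) ^ n) ^ 2 := by
        rw [mul_pow, ← pow_mul, mul_comm n 2, pow_mul]; norm_num
  obtain ⟨η, hηP, hηd, hη⟩ := l1_limit hP hρ l1
  apply hnd
  have : μ = η := by
    refine ext_lip fun f K hf hb hK => ?_
    refine tendsto_nhds_unique ?_ (hη f hf hb)
    rw [tendsto_iff_dist_tendsto_zero]
    have ht : Tendsto (fun n : ℕ => Real.sqrt ((K:ℝ) ^ 2 * (1 / ((n:ℝ)+1)))) atTop (𝓝 0) := by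
      have := (tendsto_one_div_add_atTop_nhds_zero_nat (𝕜 := ℝ)).const_mul ((K:ℝ)^2)
      have h2 := (Real.continuous_sqrt.tendsto _).comp this
      rw [mul_zero, Real.sqrt_zero] at h2
      exact h2
    refine squeeze_zero (fun n => dist_nonneg) (fun n => ?_) ht
    have := lip_test hf hb hK (c := 1 / ((n:ℝ)+1)) (by positivity)
      ((hν3 n).trans_le (ENNReal.ofReal_le_ofReal (min_le_right _ _)))
    rw [dist_comm, Real.dist_eq]
    exact Real.abs_le_sqrt this
  rw [this]; exact hηd

end lemL

section lemN
variable {X : Type*} [MetricSpace X] [MeasurableSpace X] [BorelSpace X]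

lemma dec_of_balls {m σ : Measure X} [IsFiniteMeasure σ] (x₀ : X) (n₀ : ℕ)
    (h : ∀ n : ℕ, n₀ ≤ n → Dec m (σ.restrict (Metric.ball x₀ n))) : Dec m σ := by
  let B : ℕ → Set X := fun k => Metric.ball x₀ ((k + n₀ : ℕ) : ℝ)
  have hBm : ∀ k, MeasurableSet (B k) := fun k => measurableSet_ball
  have hd : ∀ k, Dec m (σ.restrict (disjointed B k)) := fun k =>
    (h (k + n₀) (Nat.le_add_left _ _)).of_ac
      (Measure.absolutelyContinuous_of_le (Measure.restrict_mono (disjointed_subset B k) le_rfl))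
  have hU : ⋃ k, disjointed B k = Set.univ := by
    rw [iUnion_disjointed, Set.eq_univ_iff_forall]
    intro x
    obtain ⟨k, hk⟩ := exists_nat_gt (dist x x₀)
    refine Set.mem_iUnion.2 ⟨k, ?_⟩
    simp only [B, Metric.mem_ball]
    refine hk.trans_le ?_
    push_cast
    linarith [(Nat.cast_nonneg n₀ : (0:ℝ) ≤ n₀)]
  have hsum : σ = Measure.sum fun k => σ.restrict (disjointed B k) := by
    rw [← Measure.restrict_iUnion (disjoint_disjointed B)
      (fun k => MeasurableSet.disjointed hBm k), hU, Measure.restrict_univ]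
  choose ρ hρ using hd
  refine dec_of_withDensity (f := ∑' k, fun x => ENNReal.ofReal (ρ k x))
    (Measurable.ennreal_tsum' fun k => (hρ k).1.ennreal_ofReal) ?_
  rw [withDensity_tsum fun k => (hρ k).1.ennreal_ofReal]
  conv_lhs => rw [hsum]
  congr 1
  ext1 k
  exact (hρ k).2.2

lemma lemN {m μ σ : Measure X} [IsProbabilityMeasure μ] [IsProbabilityMeasure σ] (hμ : μ ≪ m)
    (hσ : σ ≪ m) (hnd : ¬ Dec m σ) (hs : entDescSlope m μ ≠ ⊤) : relEnt m μ ≤ 0 := by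
  obtain ⟨x₀⟩ : Nonempty X := nonempty_of_isProbabilityMeasure μ
  obtain ⟨n₀, hn₀⟩ : ∃ n₀ : ℕ, ∀ n ≥ n₀, μ (Metric.ball x₀ n) ≠ 0 := by
    by_contra! hcon
    have h1 : ∀ k : ℕ, μ (Metric.ball x₀ k) = 0 := fun k => by
      obtain ⟨n, hn, h⟩ := hcon k
      exact measure_mono_null (Metric.ball_subset_ball (by exact_mod_cast hn)) h
    have h2 : μ (⋃ k : ℕ, Metric.ball x₀ k) = 0 := measure_iUnion_null h1
    rw [Metric.iUnion_ball_nat, measure_univ] at h2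
    exact one_ne_zero h2
  obtain ⟨n, hn, hndn⟩ : ∃ n ≥ n₀, ¬ Dec m (σ.restrict (Metric.ball x₀ n)) := by
    by_contra! hcon
    exact hnd (dec_of_balls x₀ n₀ hcon)
  set B := Metric.ball x₀ (n:ℝ) with hB
  have hBm : MeasurableSet B := measurableSet_ball
  have hb := hn₀ n hn
  set b := μ B with hbdef
  have hq : σ B ≠ 0 := by
    intro h0
    apply hndn
    rw [Measure.restrict_eq_zero.2 h0]
    exact ⟨fun _ => 0, measurable_const, fun _ => le_rfl, by simp⟩
  set τ := (σ B)⁻¹ • σ.restrict B with hτ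
  have hτP : IsProbabilityMeasure τ := by
    constructor
    rw [hτ, Measure.smul_apply, Measure.restrict_apply_univ, smul_eq_mul,
      ENNReal.inv_mul_cancel hq (measure_ne_top _ _)]
  have key : ∀ t : ℝ, 0 < t → t < 1 → ∃ ν, MemEntDom m ν ∧ relEnt m ν = 0 ∧
      W2sq μ ν ≤ ENNReal.ofReal (t * (2 * n) ^ 2) := by
    intro t ht ht1
    set κ := μ.restrict Bᶜ + ENNReal.ofReal (1 - t) • μ.restrict B with hκ
    set π := κ.map (fun x => (x, x)) + ENNReal.ofReal t • (μ.restrict B).prod τ with hπ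
    have mdiag : Measurable fun x : X => (x, x) := measurable_id.prodMk measurable_id
    have e1 : π.map Prod.fst = μ := by
      rw [hπ, Measure.map_add _ _ measurable_fst, Measure.map_smul, Measure.map_fst_prod,
        Measure.map_map measurable_fst mdiag, measure_univ, one_smul]
      have : (Prod.fst ∘ fun x : X => (x, x)) = id := rfl
      rw [this, Measure.map_id, hκ, add_assoc, ← add_smul,
        ← ENNReal.ofReal_add (by linarith) ht.le]
      simp [add_comm (μ.restrict Bᶜ), Measure.restrict_add_restrict_compl hBm]
    have e2 : π.map Prod.snd = κ + ENNReal.ofReal t • b • τ := by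
      rw [hπ, Measure.map_add _ _ measurable_snd, Measure.map_smul, Measure.map_snd_prod,
        Measure.map_map measurable_snd mdiag, Measure.restrict_apply_univ]
      have : (Prod.snd ∘ fun x : X => (x, x)) = id := rfl
      rw [this, Measure.map_id]
    set ν := π.map Prod.snd with hν
    have hc : IsCoup π μ ν := ⟨e1, rfl⟩
    have hπP := hc.prob
    have hνP : IsProbabilityMeasure ν := Measure.isProbabilityMeasure_map measurable_snd.aemeasurable
    have hτm : τ ≪ m :=
      (Measure.smul_absolutelyContinuous.trans
        (Measure.absolutelyContinuous_of_le Measure.restrict_le_self)).trans hσ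
    have hνm : ν ≪ m := by
      rw [e2, hκ]
      refine Measure.AbsolutelyContinuous.add_left (Measure.AbsolutelyContinuous.add_left ?_ ?_) ?_
      · exact (Measure.absolutelyContinuous_of_le Measure.restrict_le_self).trans hμ
      · exact (Measure.smul_absolutelyContinuous.trans
          (Measure.absolutelyContinuous_of_le Measure.restrict_le_self)).trans hμ
      · exact Measure.smul_absolutelyContinuous.trans
          (Measure.smul_absolutelyContinuous.trans hτm)
    have hνd : ¬ Dec m ν := by
      intro hd
      apply hndn
      refine hd.of_ac (Measure.AbsolutelyContinuous.mk fun s hs h0 => ?_)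
      rw [e2] at h0
      simp only [Measure.add_apply, Measure.smul_apply, hτ, smul_eq_mul, add_eq_zero,
        mul_eq_zero, ENNReal.inv_eq_zero] at h0
      rcases h0.2 with h | h | h | h
      · simp [ht.not_ge] at h
      · exact absurd h hb
      · exact absurd h (measure_ne_top _ _)
      · exact h
    refine ⟨ν, not_dec_memEntDom hνm hνd, not_dec_relEnt hνm hνd, (W2sq_le hc).trans ?_⟩
    rw [hπ, lintegral_add_measure, lintegral_smul_measure]
    have z : ∫⁻ p, edist p.1 p.2 ^ 2 ∂(κ.map fun x => (x, x)) = 0 := by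
      refine le_antisymm ((lintegral_map_le _ _).trans ?_) bot_le
      simp
    rw [z, zero_add, smul_eq_mul, ENNReal.ofReal_mul ht.le]
    gcongr
    have a1 : ∀ᵐ p ∂((μ.restrict B).prod τ), p.1 ∈ B :=
      Measure.quasiMeasurePreserving_fst.ae (ae_restrict_mem hBm)
    have hτB : ∀ᵐ x ∂τ, x ∈ B :=
      Measure.smul_absolutelyContinuous.ae_le (ae_restrict_mem hBm)
    have a2 : ∀ᵐ p ∂((μ.restrict B).prod τ), p.2 ∈ B :=
      Measure.quasiMeasurePreserving_snd.ae hτB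
    calc ∫⁻ p, edist p.1 p.2 ^ 2 ∂((μ.restrict B).prod τ)
        ≤ ∫⁻ p, ENNReal.ofReal ((2 * n) ^ 2) ∂((μ.restrict B).prod τ) := by
          refine lintegral_mono_ae ?_
          filter_upwards [a1, a2] with p h1 h2
          rw [edist_dist, ← ENNReal.ofReal_pow dist_nonneg]
          refine ENNReal.ofReal_le_ofReal (pow_le_pow_left₀ dist_nonneg ?_ 2)
          have := dist_triangle_right p.1 p.2 x₀
          rw [hB, Metric.mem_ball] at h1 h2
          linarith
      _ ≤ ENNReal.ofReal ((2 * n) ^ 2) := by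
          rw [lintegral_const, ← Set.univ_prod_univ, Measure.prod_prod,
            measure_univ (μ := τ), mul_one, Measure.restrict_apply_univ]
          exact mul_le_of_le_one_right bot_le prob_le_one
  obtain ⟨ε, hε, hsl⟩ := slope_bound hs one_pos
  have hlim : Tendsto (fun t : ℝ => ((entDescSlope m μ).toReal + 1) *
      Real.sqrt (t * (2 * n) ^ 2)) (𝓝[>] 0) (𝓝 0) := by
    have : Continuous fun t : ℝ => ((entDescSlope m μ).toReal + 1) *
      Real.sqrt (t * (2 * n) ^ 2) := by fun_prop
    have h := (this.tendsto 0).mono_left (nhdsWithin_le_nhds (s := Set.Ioi 0))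
    simpa using h
  have hlim2 : Tendsto (fun t : ℝ => t * (2 * (n:ℝ)) ^ 2) (𝓝[>] 0) (𝓝 0) := by
    have : Continuous fun t : ℝ => t * (2 * (n:ℝ)) ^ 2 := by fun_prop
    have h := (this.tendsto 0).mono_left (nhdsWithin_le_nhds (s := Set.Ioi 0))
    simpa using h
  refine ge_of_tendsto hlim ?_
  filter_upwards [Ioo_mem_nhdsGT one_pos, hlim2.eventually_lt_const hε] with t ht htε
  obtain ⟨ν, h1, h2, h3⟩ := key t ht.1 ht.2
  have := hsl ν _ h1 htε h3
  rwa [h2, sub_zero] at this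

end lemN

section main
variable {X : Type*} [MeasurableSpace X]

lemma SplitData.dec {m μ μ₁ μ₂ : Measure X} {a₁ a₂ : ℝ} {u : X → ℝ}
    (h : SplitData μ μ₁ μ₂ a₁ a₂ u) (ha₁ : 0 < a₁) (ha₂ : 0 < a₂) (hd : Dec m μ) :
    Dec m μ₁ ∧ Dec m μ₂ := by
  obtain ⟨ρ, hρ⟩ := hd
  exact ⟨⟨_, hρ.piece ha₁ h.meas (fun x => (h.bd x).1) h.e₁⟩,
    ⟨_, hρ.piece (u := fun x => 1 - u x) ha₂ (measurable_const.sub h.meas)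
      (fun x => by linarith [(h.bd x).2]) h.e₂⟩⟩

lemma SplitData.int_h_nonneg {μ μ₁ μ₂ : Measure X} {a₁ a₂ : ℝ} {u : X → ℝ}
    (h : SplitData μ μ₁ μ₂ a₁ a₂ u) : 0 ≤ ∫ x, Real.binEntropy (u x) ∂μ :=
  integral_nonneg fun x => Real.binEntropy_nonneg (h.bd x).1 (h.bd x).2

lemma SplitData.int_h_le {μ μ₁ μ₂ : Measure X} {a₁ a₂ : ℝ} {u : X → ℝ}
    [IsProbabilityMeasure μ] [IsProbabilityMeasure μ₁]
    (h : SplitData μ μ₁ μ₂ a₁ a₂ u) (ha₁ : 0 < a₁) (ha₂ : 0 < a₂) (hsum : a₁ + a₂ = 1) :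
    ∫ x, Real.binEntropy (u x) ∂μ ≤ Real.binEntropy a₁ := by
  have iu : Integrable u μ := bdd_integrable h.meas 1 fun x =>
    abs_le.2 ⟨by linarith [(h.bd x).1], (h.bd x).2⟩
  have ib : Integrable (fun x => Real.binEntropy (u x)) μ :=
    bdd_integrable (Real.binEntropy_continuous.measurable.comp h.meas) (Real.log 2)
      fun x => binEntropy_abs_le (h.bd x)
  have i1 : Integrable (fun x => u x * (Real.log (1 - a₁) - Real.log a₁)) μ := iu.mul_const _
  have h1 : ∫ x, Real.binEntropy (u x) ∂μ ≤
      ∫ x, (u x * (Real.log (1 - a₁) - Real.log a₁) + -Real.log (1 - a₁)) ∂μ := by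
    refine integral_mono ib (i1.add (integrable_const _)) fun x => ?_
    have := gibbs (w := a₁) (h.bd x).1 (h.bd x).2 ha₁ (by linarith)
    simp only
    linarith
  rw [integral_add i1 (integrable_const _), integral_mul_const, h.int_u ha₁] at h1
  simp only [integral_const, probReal_univ, one_smul] at h1
  rw [Real.binEntropy_eq_negMulLog_add_negMulLog_one_sub]
  simp only [Real.negMulLog]
  linarith

end main

section main2
variable {X : Type*} [MetricSpace X] [MeasurableSpace X] [BorelSpace X]

lemma nd_sum {m μ₁ μ₂ : Measure X} [IsProbabilityMeasure μ₁] [IsProbabilityMeasure μ₂]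
    (hs₁ : entDescSlope m μ₁ ≠ ⊤) (hs₂ : entDescSlope m μ₂ ≠ ⊤) (hnd : ¬ Dec m μ₁)
    {a₁ a₂ : ℝ} (ha₁ : 0 < a₁) (ha₂ : 0 < a₂) :
    ∃ e : ℝ, 0 < e ∧ ∀ ν₁ ν₂, MemEntDom m ν₁ → MemEntDom m ν₂ → Dec m ν₁ →
      W2sq μ₁ ν₁ < ENNReal.ofReal e → W2sq μ₂ ν₂ < ENNReal.ofReal e →
      Real.log 2 ≤ a₁ * relEnt m ν₁ + a₂ * relEnt m ν₂ := by
  obtain ⟨e₂, B, he₂, hB⟩ := lower_bound hs₂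
  obtain ⟨e₁, he₁, hC⟩ := lemL hs₁ hnd ((Real.log 2 - a₂ * B) / a₁)
  refine ⟨min e₁ e₂, lt_min he₁ he₂, fun ν₁ ν₂ d1 d2 hd w1 w2 => ?_⟩
  have k1 := hC ν₁ d1 hd (w1.trans_le (ENNReal.ofReal_le_ofReal (min_le_left _ _)))
  have k2 := hB ν₂ d2 (w2.trans_le (ENNReal.ofReal_le_ofReal (min_le_right _ _)))
  rw [div_le_iff₀ ha₁] at k1
  have := mul_le_mul_of_nonneg_left k2 ha₂.le
  linarith

lemma cs_aux {a₁ a₂ k₁ k₂ c₁ c₂ c : ℝ} (ha₁ : 0 < a₁) (ha₂ : 0 < a₂) (h₁ : 0 ≤ c₁) (h₂ : 0 ≤ c₂)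
    (hc : a₁ * c₁ + a₂ * c₂ ≤ c) :
    a₁ * (k₁ * Real.sqrt c₁) + a₂ * (k₂ * Real.sqrt c₂) ≤
      Real.sqrt (a₁ * k₁ ^ 2 + a₂ * k₂ ^ 2) * Real.sqrt c := by
  rw [← Real.sqrt_mul (by positivity)]
  refine Real.le_sqrt_of_sq_le ?_
  refine le_trans ?_ (mul_le_mul_of_nonneg_left hc (by positivity))
  obtain ⟨p, hp, rfl⟩ : ∃ p : ℝ, 0 ≤ p ∧ p ^ 2 = c₁ := ⟨_, Real.sqrt_nonneg _, Real.sq_sqrt h₁⟩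
  obtain ⟨q, hq, rfl⟩ : ∃ q : ℝ, 0 ≤ q ∧ q ^ 2 = c₂ := ⟨_, Real.sqrt_nonneg _, Real.sq_sqrt h₂⟩
  rw [Real.sqrt_sq hp, Real.sqrt_sq hq]
  nlinarith [mul_nonneg (mul_pos ha₁ ha₂).le (sq_nonneg (k₁ * q - k₂ * p))]

lemma main_bound {m μ₁ μ₂ : Measure X}
    (h₁ : MemEntDom m μ₁) (h₂ : MemEntDom m μ₂)
    (hs₁ : entDescSlope m μ₁ ≠ ⊤) (hs₂ : entDescSlope m μ₂ ≠ ⊤)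
    {a₁ a₂ : ℝ} (ha₁ : 0 < a₁) (ha₂ : 0 < a₂) (hsum : a₁ + a₂ = 1) {δ : ℝ} (hδ : 0 < δ) :
    entDescSlope m (ENNReal.ofReal a₁ • μ₁ + ENNReal.ofReal a₂ • μ₂) ≤
      ENNReal.ofReal (Real.sqrt (a₁ * ((entDescSlope m μ₁).toReal + δ) ^ 2 +
        a₂ * ((entDescSlope m μ₂).toReal + δ) ^ 2)) := by
  have P1 : IsProbabilityMeasure μ₁ := h₁.1
  have P2 : IsProbabilityMeasure μ₂ := h₂.1
  have P := half_sum μ₁ μ₂ ha₁ ha₂ hsum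
  obtain ⟨u, hu⟩ := exists_splitData μ₁ μ₂ ha₁ ha₂ hsum
  have hdec := fun (h : Dec m μ₁) (h' : Dec m μ₂) => dec_comb h h' a₁ a₂
  set μ := ENNReal.ofReal a₁ • μ₁ + ENNReal.ofReal a₂ • μ₂ with hμ
  have hμm : μ ≪ m := by
    refine Measure.AbsolutelyContinuous.add_left ?_ ?_
    · exact Measure.smul_absolutelyContinuous.trans h₁.2.1
    · exact Measure.smul_absolutelyContinuous.trans h₂.2.1
  obtain ⟨e₁, he₁, B₁⟩ := slope_bound hs₁ hδ
  obtain ⟨e₂, he₂, B₂⟩ := slope_bound hs₂ hδ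
  set k₁ := (entDescSlope m μ₁).toReal + δ with hk₁
  set k₂ := (entDescSlope m μ₂).toReal + δ with hk₂
  obtain ⟨e₃, he₃, B₃⟩ : ∃ e : ℝ, 0 < e ∧ (¬ Dec m μ → ∀ ν₁ ν₂, MemEntDom m ν₁ → MemEntDom m ν₂ →
      Dec m ν₁ → Dec m ν₂ →
      W2sq μ₁ ν₁ < ENNReal.ofReal e → W2sq μ₂ ν₂ < ENNReal.ofReal e →
      Real.log 2 ≤ a₁ * relEnt m ν₁ + a₂ * relEnt m ν₂) := by
    by_cases hd : Dec m μ
    · exact ⟨1, one_pos, fun h => absurd hd h⟩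
    by_cases hd1 : Dec m μ₁
    · have hd2 : ¬ Dec m μ₂ := fun h => hd (hdec hd1 h)
      obtain ⟨e, he, h⟩ := nd_sum hs₂ hs₁ hd2 ha₂ ha₁
      refine ⟨e, he, fun _ ν₁ ν₂ d1 d2 c1 c2 w1 w2 => ?_⟩
      rw [add_comm]
      exact h ν₂ ν₁ d2 d1 c2 w2 w1
    · obtain ⟨e, he, h⟩ := nd_sum hs₁ hs₂ hd1 ha₁ ha₂
      exact ⟨e, he, fun _ ν₁ ν₂ d1 d2 c1 c2 w1 w2 => h ν₁ ν₂ d1 d2 c1 w1 w2⟩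
  have hK : 0 ≤ Real.sqrt (a₁ * k₁ ^ 2 + a₂ * k₂ ^ 2) := Real.sqrt_nonneg _
  set M := min (min e₁ e₂) e₃ with hM
  have hM0 : 0 < M := lt_min (lt_min he₁ he₂) he₃
  refine slope_le hK (ε := min a₁ a₂ * M) (mul_pos (lt_min ha₁ ha₂) hM0) fun ν c hν hc0 hc hW => ?_
  have Pν : IsProbabilityMeasure ν := hν.1
  have hr : 0 ≤ Real.sqrt (a₁ * k₁ ^ 2 + a₂ * k₂ ^ 2) * Real.sqrt c :=
    mul_nonneg hK (Real.sqrt_nonneg _)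
  by_cases hνd : Dec m ν
  swap
  · -- the competitor has no density
    rw [not_dec_relEnt hν.2.1 hνd, sub_zero]
    refine le_trans ?_ hr
    by_cases hμd : Dec m μ
    · have n1 := lemN h₁.2.1 hν.2.1 hνd hs₁
      have n2 := lemN h₂.2.1 hν.2.1 hνd hs₂
      obtain ⟨E1, E2⟩ := hu.entropy ha₁ ha₂ hsum hμd
      have E3 := E2 (E1.2 ⟨h₁, h₂⟩)
      have E4 := hu.int_h_le ha₁ ha₂ hsum
      have q1 := mul_nonneg ha₁.le (neg_nonneg.2 n1)
      have q2 := mul_nonneg ha₂.le (neg_nonneg.2 n2)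
      linarith
    · rw [not_dec_relEnt hμm hμd]
  obtain ⟨π, hπ, hcost⟩ := exists_coup hW
  obtain ⟨ν₁, ν₂, π₁, π₂, v, Q1, Q2, c1, c2, hsplit, hv, hj⟩ :=
    split_coupling ha₁ ha₂ hu hπ (fun p => edist p.1 p.2 ^ 2)
  obtain ⟨d1, d2⟩ := hv.dec ha₁ ha₂ hνd
  obtain ⟨F1, F2⟩ := hv.entropy ha₁ ha₂ hsum hνd
  obtain ⟨m1, m2⟩ := F1.1 hν
  have F3 := F2 hν
  -- the costs of the two pieces
  set C₁ := ∫⁻ p, edist p.1 p.2 ^ 2 ∂π₁ with hC₁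
  set C₂ := ∫⁻ p, edist p.1 p.2 ^ 2 ∂π₂ with hC₂
  have hlt : ENNReal.ofReal a₁ * C₁ + ENNReal.ofReal a₂ * C₂ < ENNReal.ofReal c := by
    rw [hsplit]; exact hcost
  have n1 : C₁ ≠ ⊤ := by
    intro h
    rw [h, ENNReal.mul_top (by simpa using ha₁), top_add] at hlt
    exact not_top_lt hlt
  have n2 : C₂ ≠ ⊤ := by
    intro h
    rw [h, ENNReal.mul_top (by simpa using ha₂), add_top] at hlt
    exact not_top_lt hlt
  obtain ⟨r₁, hr₁, e1⟩ : ∃ r : ℝ, 0 ≤ r ∧ C₁ = ENNReal.ofReal r :=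
    ⟨_, ENNReal.toReal_nonneg, (ENNReal.ofReal_toReal n1).symm⟩
  obtain ⟨r₂, hr₂, e2⟩ : ∃ r : ℝ, 0 ≤ r ∧ C₂ = ENNReal.ofReal r :=
    ⟨_, ENNReal.toReal_nonneg, (ENNReal.ofReal_toReal n2).symm⟩
  have hcr : a₁ * r₁ + a₂ * r₂ < c := by
    rwa [e1, e2, ← ENNReal.ofReal_mul ha₁.le, ← ENNReal.ofReal_mul ha₂.le,
      ← ENNReal.ofReal_add (by positivity) (by positivity),
      ENNReal.ofReal_lt_ofReal_iff hc0] at hlt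
  have w1 : W2sq μ₁ ν₁ ≤ ENNReal.ofReal r₁ := by rw [← e1]; exact W2sq_le c1
  have w2 : W2sq μ₂ ν₂ ≤ ENNReal.ofReal r₂ := by rw [← e2]; exact W2sq_le c2
  have s1 : r₁ < M := by
    have : a₁ * r₁ < a₁ * M := by
      have := mul_le_mul_of_nonneg_right (min_le_left a₁ a₂) hM0.le
      have := mul_nonneg ha₂.le hr₂
      linarith
    exact lt_of_mul_lt_mul_left this ha₁.le
  have s2 : r₂ < M := by
    have : a₂ * r₂ < a₂ * M := by
      have := mul_le_mul_of_nonneg_right (min_le_right a₁ a₂) hM0.le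
      have := mul_nonneg ha₁.le hr₁
      linarith
    exact lt_of_mul_lt_mul_left this ha₂.le
  have M1 : M ≤ e₁ := (min_le_left _ _).trans (min_le_left _ _)
  have M2 : M ≤ e₂ := (min_le_left _ _).trans (min_le_right _ _)
  have M3 : M ≤ e₃ := min_le_right _ _
  by_cases hμd : Dec m μ
  · obtain ⟨E1, E2⟩ := hu.entropy ha₁ ha₂ hsum hμd
    have E3 := E2 (E1.2 ⟨h₁, h₂⟩)
    have b1 := mul_le_mul_of_nonneg_left (B₁ ν₁ r₁ m1 (s1.trans_le M1) w1) ha₁.le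
    have b2 := mul_le_mul_of_nonneg_left (B₂ ν₂ r₂ m2 (s2.trans_le M2) w2) ha₂.le
    have := cs_aux (k₁ := k₁) (k₂ := k₂) ha₁ ha₂ hr₁ hr₂ hcr.le
    linarith
  · rw [not_dec_relEnt hμm hμd]
    have l1 := B₃ hμd ν₁ ν₂ m1 m2 d1 d2
      (w1.trans_lt ((ENNReal.ofReal_lt_ofReal_iff he₃).2 (s1.trans_le M3)))
      (w2.trans_lt ((ENNReal.ofReal_lt_ofReal_iff he₃).2 (s2.trans_le M3)))
    have l2 := Real.binEntropy_le_log_two (p := a₁)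
    have l3 := hv.int_h_nonneg
    linarith

end main2

/-- Convexity of the squared Wasserstein slope of the entropy: for `μ₁, μ₂` in the
domain of `Ent_m` with finite descending slope and `α₁ + α₂ = 1`, `αᵢ ∈ (0,1)`,
the convex combination `μ = α₁μ₁ + α₂μ₂` satisfies
`|∇⁻Ent_m|²(μ) ≤ α₁|∇⁻Ent_m|²(μ₁) + α₂|∇⁻Ent_m|²(μ₂)`. -/
theorem entropy_slope_sq_convex {X : Type*} [MetricSpace X] [MeasurableSpace X]
    [BorelSpace X] (m μ₁ μ₂ : Measure X)
    (h₁ : MemEntDom m μ₁) (h₂ : MemEntDom m μ₂)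
    (hs₁ : entDescSlope m μ₁ ≠ ⊤) (hs₂ : entDescSlope m μ₂ ≠ ⊤)
    (a₁ a₂ : ℝ) (ha₁ : 0 < a₁) (ha₂ : 0 < a₂) (hsum : a₁ + a₂ = 1) :
    entDescSlope m (ENNReal.ofReal a₁ • μ₁ + ENNReal.ofReal a₂ • μ₂) ^ 2 ≤
      ENNReal.ofReal a₁ * entDescSlope m μ₁ ^ 2 +
        ENNReal.ofReal a₂ * entDescSlope m μ₂ ^ 2 := by
  set s₁ := (entDescSlope m μ₁).toReal with h_s₁
  set s₂ := (entDescSlope m μ₂).toReal with h_s₂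
  have key : entDescSlope m (ENNReal.ofReal a₁ • μ₁ + ENNReal.ofReal a₂ • μ₂) ≤
      ENNReal.ofReal (Real.sqrt (a₁ * s₁ ^ 2 + a₂ * s₂ ^ 2)) := by
    have hcont : Continuous fun δ : ℝ =>
        ENNReal.ofReal (Real.sqrt (a₁ * (s₁ + δ) ^ 2 + a₂ * (s₂ + δ) ^ 2)) := by
      refine ENNReal.continuous_ofReal.comp ?_
      fun_prop
    have ht := (hcont.tendsto 0).mono_left (nhdsWithin_le_nhds (s := Set.Ioi 0))
    simp only [add_zero] at ht
    refine ge_of_tendsto ht ?_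
    filter_upwards [self_mem_nhdsWithin] with δ hδ
    exact main_bound h₁ h₂ hs₁ hs₂ ha₁ ha₂ hsum hδ
  refine (pow_le_pow_left' key 2).trans (le_of_eq ?_)
  rw [← ENNReal.ofReal_pow (Real.sqrt_nonneg _), Real.sq_sqrt (by positivity),
    ENNReal.ofReal_add (by positivity) (by positivity), ENNReal.ofReal_mul ha₁.le,
    ENNReal.ofReal_mul ha₂.le, ENNReal.ofReal_pow ENNReal.toReal_nonneg,
    ENNReal.ofReal_pow ENNReal.toReal_nonneg, ENNReal.ofReal_toReal hs₁,
    ENNReal.ofReal_toReal hs₂]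
end
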